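/- Let n ≥ 3. There is no homeomorphism h : 𝔹 → 𝔹 ∖ I of finite bi-conformal energy; that is, there is no homeomorphism h from the unit ball 𝔹 onto the slit ball 𝔹 ∖ I with h ∈ W^{1,n}(𝔹, ℝⁿ) and h⁻¹ ∈ W^{1,n}(𝔹 ∖ I, ℝⁿ). In particular, 𝔹 and 𝔹 ∖ I are not of the same bi-conformal energy type. -/

import Mathlib

open MeasureTheory Metric Set
open scoped ENNReal NNReal

noncomputable section

abbrev Euc (n : ℕ) : Type := EuclideanSpace ℝ (Fin n)

/-- Operator norm of an `n × n` real matrix, viewed as a linear operator on Euclidean space. -/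
noncomputable def opNorm {n : ℕ} (M : Matrix (Fin n) (Fin n) ℝ) : ℝ :=
  ‖LinearMap.toContinuousLinearMap (Matrix.toEuclideanLin M)‖

/-- `g` belongs to the Sobolev class `W^{1,p}(Ω, ℝⁿ)` with weak differential `Dg`:
`g` and `Dg` are locally integrable on `Ω`, the integration-by-parts identity holds against
every smooth compactly supported test function supported in `Ω`, and `|Dg| ∈ L^p(Ω)`. -/
structure MemSobolev {n : ℕ} (p : ℝ) (Ω : Set (Euc n))
    (g : Euc n → Euc n) (Dg : Euc n → Matrix (Fin n) (Fin n) ℝ) : Prop where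
  locInt : ∀ i : Fin n, LocallyIntegrableOn (fun x => g x i) Ω volume
  locIntD : ∀ i j : Fin n, LocallyIntegrableOn (fun x => Dg x i j) Ω volume
  parts : ∀ φ : Euc n → ℝ, ContDiff ℝ ((⊤ : ℕ∞) : WithTop ℕ∞) φ → HasCompactSupport φ →
    tsupport φ ⊆ Ω → ∀ i j : Fin n,
      ∫ x in Ω, g x i * fderiv ℝ φ x (EuclideanSpace.single j 1) =
        - ∫ x in Ω, Dg x i j * φ x
  lp : IntegrableOn (fun x => opNorm (Dg x) ^ p) Ω volume

/-- `g` belongs to the local Sobolev class `W^{1,1}_loc(Ω, ℝⁿ)` with weak differential `Dg`. -/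
structure MemSobolevLoc {n : ℕ} (Ω : Set (Euc n))
    (g : Euc n → Euc n) (Dg : Euc n → Matrix (Fin n) (Fin n) ℝ) : Prop where
  locInt : ∀ i : Fin n, LocallyIntegrableOn (fun x => g x i) Ω volume
  locIntD : ∀ i j : Fin n, LocallyIntegrableOn (fun x => Dg x i j) Ω volume
  parts : ∀ φ : Euc n → ℝ, ContDiff ℝ ((⊤ : ℕ∞) : WithTop ℕ∞) φ → HasCompactSupport φ →
    tsupport φ ⊆ Ω → ∀ i j : Fin n,
      ∫ x in Ω, g x i * fderiv ℝ φ x (EuclideanSpace.single j 1) =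
        - ∫ x in Ω, Dg x i j * φ x

/-- `h : 𝕏 → 𝕐` is a homeomorphism of `𝕏` onto `𝕐` with inverse `f`. -/
structure IsHomeoOn {n : ℕ} (h f : Euc n → Euc n) (𝕏 𝕐 : Set (Euc n)) : Prop where
  mapsTo : Set.MapsTo h 𝕏 𝕐
  mapsTo_inv : Set.MapsTo f 𝕐 𝕏
  left_inv : ∀ x ∈ 𝕏, f (h x) = x
  right_inv : ∀ y ∈ 𝕐, h (f y) = y
  continuousOn : ContinuousOn h 𝕏
  continuousOn_inv : ContinuousOn f 𝕐

/-- The inner distortion function `K_I(·, h)` of a Sobolev map with weak differential `Dh`;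
`D♯h` is the cofactor (adjugate) matrix, given by Cramer's rule `(D♯h)(Dh) = (det Dh)·Id`. -/
noncomputable def innerDistortion {n : ℕ} (Dh : Euc n → Matrix (Fin n) (Fin n) ℝ)
    (x : Euc n) : ℝ≥0∞ :=
  if 0 < (Dh x).det then
    ENNReal.ofReal (opNorm ((Dh x).adjugate) ^ n / (Dh x).det ^ (n - 1))
  else if (Dh x).adjugate = 0 then 1 else ⊤

/-- The open unit ball `𝔹 ⊂ ℝⁿ`. -/
def unitBall (n : ℕ) : Set (Euc n) := Metric.ball 0 1

/-- The slit `I = {(t,0) : 0 ≤ t < 1}`, the first coordinate playing the role of `t`. -/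
def slit (n : ℕ) [NeZero n] : Set (Euc n) :=
  {p | 0 ≤ p 0 ∧ p 0 < 1 ∧ ∀ i : Fin n, i ≠ 0 → p i = 0}

/-- The model inward-cusp ball `𝔹_u = 𝔹 \ {(t,x) : t ≥ 0, |x| ≤ u(t)}`. -/
noncomputable def cuspBall (n : ℕ) [NeZero n] (u : ℝ → ℝ) : Set (Euc n) :=
  Metric.ball 0 1 \
    {p | 0 ≤ p 0 ∧ Real.sqrt (∑ i ∈ Finset.univ.erase (0 : Fin n), p i ^ 2) ≤ u (p 0)}

/-- `u` is a model cusp profile: a strictly increasing continuous surjection of `[0,∞)` onto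
itself, `C¹` on `(0,∞)`, with `u′` increasing on `(0,∞)`, `u′(s) → 0` as `s → 0⁺`, `u(1) = 1`. -/
structure IsModelCusp (u : ℝ → ℝ) : Prop where
  continuousOn : ContinuousOn u (Set.Ici 0)
  contDiffOn : ContDiffOn ℝ 1 u (Set.Ioi 0)
  strictMonoOn : StrictMonoOn u (Set.Ici 0)
  mapsTo : Set.MapsTo u (Set.Ici 0) (Set.Ici 0)
  surjOn : Set.SurjOn u (Set.Ici 0) (Set.Ici 0)
  deriv_mono : MonotoneOn (deriv u) (Set.Ioi 0)
  deriv_tendsto : Filter.Tendsto (deriv u) (nhdsWithin 0 (Set.Ioi 0)) (nhds 0)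
  one : u 1 = 1

/-- The cusp profile `u(t) = e / exp(t^{-α})` for `t > 0`, and `u(0) = 0`. -/
noncomputable def cuspFun (α : ℝ) (t : ℝ) : ℝ :=
  if 0 < t then Real.exp 1 / Real.exp (t ^ (-α)) else 0

/-- The sphere `S_t = {y ∈ 𝔹_u : |y| = t}` inside the cusp ball. -/
def cuspS (n : ℕ) [NeZero n] (u : ℝ → ℝ) (t : ℝ) : Set (Euc n) :=
  {y ∈ cuspBall n u | ‖y‖ = t}

/-- The boundary circle `C_t = {y ∈ ∂𝔹_u : |y| = t}`. -/
def cuspC (n : ℕ) [NeZero n] (u : ℝ → ℝ) (t : ℝ) : Set (Euc n) :=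
  {y ∈ frontier (cuspBall n u) | ‖y‖ = t}

/-- `S′_t = h⁻¹(S_t) ⊆ 𝔹`. -/
def cuspS' (n : ℕ) [NeZero n] (u : ℝ → ℝ) (h : Euc n → Euc n) (t : ℝ) : Set (Euc n) :=
  {x ∈ unitBall n | h x ∈ cuspS n u t}

/-- `C′_t = cl(S′_t) ∩ ∂𝔹`. -/
def cuspC' (n : ℕ) [NeZero n] (u : ℝ → ℝ) (h : Euc n → Euc n) (t : ℝ) : Set (Euc n) :=
  closure (cuspS' n u h t) ∩ Metric.sphere (0 : Euc n) 1

/-! ### Analytic lemmas -/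

open Filter Topology

lemma curve_bound {E : Type*} [NormedAddCommGroup E] [NormedSpace ℝ E] {v : E → ℝ}
    (hv : ContDiff ℝ 1 v) {γ : ℝ → E} (hγ : Continuous γ) {L : ℝ≥0}
    (hL : LipschitzOnWith L γ (Icc 0 1)) :
    ‖v (γ 1) - v (γ 0)‖ₑ ≤ L * ∫⁻ τ in Ioo (0:ℝ) 1, ‖fderiv ℝ v (γ τ)‖ₑ := by
  set g : ℝ → ℝ := fun τ => L * ‖fderiv ℝ v (γ τ)‖ with hg
  have hgc : Continuous g :=
    continuous_const.mul (((hv.continuous_fderiv one_ne_zero).comp hγ).norm)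
  have key : ∀ ε > 0, ‖v (γ 1) - v (γ 0)‖ ≤ ∫ s in (0:ℝ)..1, (g s + ε) := by
    intro ε hε
    have := image_norm_le_of_liminf_right_slope_norm_lt_deriv_boundary
      (f := fun τ => v (γ τ) - v (γ 0)) (f' := g) (a := 0) (b := 1)
      (B := fun τ => ∫ s in (0:ℝ)..τ, (g s + ε)) (B' := fun τ => g τ + ε)
      (((hv.continuous.comp hγ).sub continuous_const).continuousOn) ?_ (by simp)
      ?_ ?_ ?_
    · exact this (right_mem_Icc.2 zero_le_one)
    · intro x hx r hr
      apply Eventually.frequently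
      -- choose η with L * (‖Dv‖ + η) < r
      obtain ⟨η, hη0, hη⟩ : ∃ η > 0, L * (‖fderiv ℝ v (γ x)‖ + η) < r := by
        have hc : Tendsto (fun η : ℝ => L * (‖fderiv ℝ v (γ x)‖ + η)) (𝓝[>] 0) (𝓝 (L * (‖fderiv ℝ v (γ x)‖ + 0))) :=
          (Continuous.tendsto (by fun_prop) 0).mono_left nhdsWithin_le_nhds
        have := (hc.eventually (gt_mem_nhds (by simpa [hg] using hr))).and self_mem_nhdsWithin
        obtain ⟨η, h1, h2⟩ := this.exists
        exact ⟨η, h2, h1⟩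
      have hd : HasFDerivAt v (fderiv ℝ v (γ x)) (γ x) :=
        (hv.differentiable one_ne_zero _).hasFDerivAt
      have h1 := (hγ.tendsto x).eventually (hd.isLittleO.def hη0)
      have h2 : ∀ᶠ z in 𝓝[>] x, z ∈ Ioc x 1 := Ioc_mem_nhdsGT hx.2
      filter_upwards [h2, mem_nhdsWithin_of_mem_nhds h1] with z hz hz1
      have hzx : 0 < z - x := sub_pos.2 hz.1
      rw [slope_def_field, div_lt_iff₀ hzx]
      have hlip : ‖γ z - γ x‖ ≤ L * (z - x) := by
        have := hL.dist_le_mul z ⟨hx.1.trans hz.1.le, hz.2⟩ x ⟨hx.1, hx.2.le⟩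
        rwa [dist_eq_norm, Real.dist_eq, abs_of_pos hzx] at this
      have hz2 : ‖v (γ z) - v (γ x)‖ ≤ (‖fderiv ℝ v (γ x)‖ + η) * ‖γ z - γ x‖ := by
        calc ‖v (γ z) - v (γ x)‖
            = ‖(v (γ z) - v (γ x) - fderiv ℝ v (γ x) (γ z - γ x))
                + fderiv ℝ v (γ x) (γ z - γ x)‖ := by congr 1; ring
          _ ≤ η * ‖γ z - γ x‖ + ‖fderiv ℝ v (γ x)‖ * ‖γ z - γ x‖ :=
              (norm_add_le _ _).trans (add_le_add hz1 (ContinuousLinearMap.le_opNorm _ _))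
          _ = _ := by ring
      calc (norm ∘ fun τ => v (γ τ) - v (γ 0)) z - (norm ∘ fun τ => v (γ τ) - v (γ 0)) x
          ≤ ‖(v (γ z) - v (γ 0)) - (v (γ x) - v (γ 0))‖ := norm_sub_norm_le _ _
        _ = ‖v (γ z) - v (γ x)‖ := by congr 1; ring
        _ ≤ (‖fderiv ℝ v (γ x)‖ + η) * (L * (z - x)) :=
            hz2.trans (mul_le_mul_of_nonneg_left hlip (by positivity))
        _ = (L * (‖fderiv ℝ v (γ x)‖ + η)) * (z - x) := by ring
        _ < r * (z - x) := mul_lt_mul_of_pos_right hη hzx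
    · exact (intervalIntegral.continuous_primitive
        (fun a b => (hgc.add continuous_const).intervalIntegrable a b) 0).continuousOn
    · intro x _
      exact ((hgc.add continuous_const).integral_hasStrictDerivAt 0 x).hasDerivAt.hasDerivWithinAt
    · intro x _ _
      linarith
  have key2 : ‖v (γ 1) - v (γ 0)‖ ≤ ∫ s in (0:ℝ)..1, g s := by
    refine le_of_forall_pos_le_add fun ε hε => (key ε hε).trans ?_
    rw [intervalIntegral.integral_add (hgc.intervalIntegrable _ _)
      (continuous_const.intervalIntegrable _ _)]
    simp
  rw [intervalIntegral.integral_of_le zero_le_one, integral_Ioc_eq_integral_Ioo] at key2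
  rw [← ofReal_norm]
  refine (ENNReal.ofReal_le_ofReal key2).trans ?_
  rw [ofReal_integral_eq_lintegral_ofReal, ← lintegral_const_mul' _ _ ENNReal.coe_ne_top]
  · refine lintegral_mono fun τ => ?_
    simp only [hg]
    rw [ENNReal.ofReal_mul (NNReal.coe_nonneg L), ofReal_norm, ENNReal.ofReal_coe_nnreal]
  · exact (hgc.integrableOn_Icc (a := 0) (b := 1)).mono_set Ioo_subset_Icc_self
  · exact Eventually.of_forall fun τ => by positivity

lemma lintegral_comp_homothety_le {m : ℕ} {S : Set (Fin m → ℝ)} (hS : Convex ℝ S)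
    (hSm : MeasurableSet S) {F : (Fin m → ℝ) → ℝ≥0∞} (hF : Measurable F) {a : Fin m → ℝ}
    (ha : a ∈ S) {τ : ℝ} (hτ : τ ∈ Ioo (0:ℝ) 1) :
    ∫⁻ z in S, F (a + τ • (z - a)) ≤ ENNReal.ofReal ((τ ^ m)⁻¹) * ∫⁻ z in S, F z := by
  have hFi : Measurable (S.indicator F) := hF.indicator hSm
  have h1 : ∫⁻ z in S, F (a + τ • (z - a)) ≤ ∫⁻ z, S.indicator F (τ • z + (a - τ • a)) := by
    rw [← lintegral_indicator hSm]
    refine lintegral_mono fun z => ?_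
    by_cases hz : z ∈ S
    · have : τ • z + (a - τ • a) = a + τ • (z - a) := by rw [smul_sub]; abel
      rw [indicator_of_mem hz, this, indicator_of_mem]
      exact hS.add_smul_sub_mem ha hz ⟨hτ.1.le, hτ.2.le⟩
    · rw [indicator_of_notMem hz]; exact zero_le
  refine h1.trans (le_of_eq ?_)
  have h2 : ∫⁻ z, S.indicator F (τ • z + (a - τ • a))
      = ∫⁻ w, S.indicator F (w + (a - τ • a)) ∂(Measure.map (τ • ·) volume) := by
    exact (lintegral_map (hFi.comp (measurable_add_const (a - τ • a)))
      (measurable_const_smul τ)).symm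
  rw [h2, Measure.map_addHaar_smul _ hτ.1.ne', lintegral_smul_measure,
    lintegral_add_right_eq_self (μ := volume) (S.indicator F), lintegral_indicator hSm]
  have : 0 < τ := hτ.1
  rw [abs_of_nonneg (by positivity)]
  simp

lemma morrey (m : ℕ) (hm : 1 ≤ m) : ∃ C : ℝ≥0∞, C ≠ ⊤ ∧ ∀ ρ : ℝ, 0 < ρ →
    ∀ S : Set (Fin m → ℝ), Convex ℝ S → MeasurableSet S → S ⊆ ball 0 ρ →
    ENNReal.ofReal ((ρ / 2) ^ m) ≤ volume S →
    ∀ gr : (Fin m → ℝ) → ℝ≥0∞, Measurable gr → ∀ φ : (Fin m → ℝ) → ℝ, ∀ Λ : ℝ≥0∞, Λ ≠ ⊤ →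
    (∀ a ∈ S, ∀ z ∈ S, ‖φ a - φ z‖ₑ ≤ Λ * ∫⁻ τ in Ioo (0:ℝ) 1, gr (a + τ • (z - a))) →
    ∀ a ∈ S, ∀ b ∈ S, ‖φ a - φ b‖ₑ ^ (m + 1) ≤
      C * Λ ^ (m + 1) * (ENNReal.ofReal (ρ ^ m))⁻¹ * ∫⁻ z in S, gr z ^ (m + 1) := by
  have hm0 : (0:ℝ) < m := by exact_mod_cast hm
  set p : ℝ := (m:ℝ) + 1 with hp
  have hp0 : 0 < p := by positivity
  set q : ℝ := p / m with hq
  have hpq : p.HolderConjugate q := by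
    rw [Real.holderConjugate_iff]
    refine ⟨by linarith, ?_⟩
    rw [hq]; field_simp; rw [hp]; ring
  set T : ℝ≥0∞ := ∫⁻ τ in Ioo (0:ℝ) 1, ENNReal.ofReal (τ ^ (-(m / p))) with hT
  have hTtop : T ≠ ⊤ := by
    have : IntegrableOn (fun τ : ℝ => τ ^ (-(m / p))) (Ioo 0 1) := by
      rw [intervalIntegral.integrableOn_Ioo_rpow_iff zero_lt_one]
      have : (m:ℝ) / p < 1 := by rw [div_lt_one hp0]; linarith
      linarith
    have h2 := this.lintegral_lt_top
    exact h2.ne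
  refine ⟨(2 * T) ^ (m + 1) * 2 ^ m, by finiteness, ?_⟩
  intro ρ hρ S hSc hSm hSb hV gr hgr φ Λ hΛ hug a ha b hb
  set V := volume S with hVdef
  have hVtop : V ≠ ⊤ := ((measure_mono hSb).trans_lt measure_ball_lt_top).ne
  have hV0 : V ≠ 0 := by
    have : (0:ℝ≥0∞) < ENNReal.ofReal ((ρ / 2) ^ m) := by
      rw [ENNReal.ofReal_pos]; positivity
    exact (this.trans_le hV).ne'
  set A := ∫⁻ z in S, gr z ^ (m + 1) with hA
  have hmeas : ∀ a : Fin m → ℝ,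
      Measurable fun x : (Fin m → ℝ) × ℝ => gr (a + x.2 • (x.1 - a)) := fun a =>
    hgr.comp (by fun_prop)
  have hstep : ∀ a ∈ S, ∫⁻ z in S, ∫⁻ τ in Ioo (0:ℝ) 1, gr (a + τ • (z - a)) ≤
      T * (A ^ (1 / p) * V ^ (1 / q)) := by
    intro a ha
    rw [lintegral_lintegral_swap (hmeas a).aemeasurable, hT,
      ← lintegral_mul_const _ (by fun_prop)]
    refine setLIntegral_mono (by fun_prop) fun τ hτ => ?_
    have h1 := ENNReal.lintegral_mul_le_Lp_mul_Lq (volume.restrict S) hpq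
      (f := fun z => gr (a + τ • (z - a))) (g := fun _ => 1)
      (hgr.comp (by fun_prop)).aemeasurable aemeasurable_const
    simp only [Pi.mul_apply, mul_one, ENNReal.one_rpow, lintegral_const, one_mul,
      Measure.restrict_apply MeasurableSet.univ, univ_inter] at h1
    refine h1.trans ?_
    rw [← mul_assoc]
    gcongr
    have h2 : ∀ x : ℝ≥0∞, x ^ p = x ^ (m + 1) := fun x => by
      rw [hp, ← ENNReal.rpow_natCast]; norm_cast
    simp only [h2]
    have h3 := lintegral_comp_homothety_le hSc hSm (hgr.pow_const (m + 1)) ha hτ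
    calc _ ≤ (ENNReal.ofReal ((τ ^ m)⁻¹) * A) ^ (1 / p) := by gcongr
      _ = _ := by
        rw [ENNReal.mul_rpow_of_nonneg _ _ (by positivity),
          ENNReal.ofReal_rpow_of_pos (by have := hτ.1; positivity)]
        congr 2
        rw [← Real.rpow_natCast, ← Real.rpow_neg hτ.1.le, ← Real.rpow_mul hτ.1.le]
        congr 1
        ring
  have hmain : V * ‖φ a - φ b‖ₑ ≤ 2 * Λ * (T * (A ^ (1 / p) * V ^ (1 / q))) := by
    have hmi : ∀ a : Fin m → ℝ,
        Measurable fun z => ∫⁻ τ in Ioo (0:ℝ) 1, gr (a + τ • (z - a)) := fun a =>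
      (hmeas a).lintegral_prod_right'
    calc V * ‖φ a - φ b‖ₑ = ∫⁻ _ in S, ‖φ a - φ b‖ₑ := by
          rw [setLIntegral_const, mul_comm]
      _ ≤ ∫⁻ z in S, (Λ * (∫⁻ τ in Ioo (0:ℝ) 1, gr (a + τ • (z - a))) +
            Λ * ∫⁻ τ in Ioo (0:ℝ) 1, gr (b + τ • (z - b))) := by
          refine setLIntegral_mono (((hmi a).const_mul _).add ((hmi b).const_mul _))
            fun z hz => ?_
          have : φ a - φ b = (φ a - φ z) - (φ b - φ z) := by ring
          rw [this]
          exact (enorm_sub_le).trans (add_le_add (hug a ha z hz) (hug b hb z hz))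
      _ = Λ * (∫⁻ z in S, ∫⁻ τ in Ioo (0:ℝ) 1, gr (a + τ • (z - a))) +
          Λ * (∫⁻ z in S, ∫⁻ τ in Ioo (0:ℝ) 1, gr (b + τ • (z - b))) := by
          rw [lintegral_add_left ((hmi a).const_mul _), lintegral_const_mul' _ _ hΛ,
            lintegral_const_mul' _ _ hΛ]
      _ ≤ Λ * (T * (A ^ (1 / p) * V ^ (1 / q))) + Λ * (T * (A ^ (1 / p) * V ^ (1 / q))) := by
          gcongr
          · exact hstep a ha
          · exact hstep b hb
      _ = _ := by ring
  have hpow : V ^ (m + 1) * ‖φ a - φ b‖ₑ ^ (m + 1) ≤ (2 * Λ * T) ^ (m + 1) * (A * V ^ m) := by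
    have h := pow_le_pow_left₀ zero_le hmain (m + 1)
    rw [mul_pow] at h
    refine h.trans (le_of_eq ?_)
    have e1 : (A ^ (1 / p)) ^ (m + 1) = A := by
      rw [← ENNReal.rpow_natCast, ← ENNReal.rpow_mul]
      push_cast
      rw [← hp, one_div_mul_cancel hp0.ne', ENNReal.rpow_one]
    have e2 : (V ^ (1 / q)) ^ (m + 1) = V ^ m := by
      rw [← ENNReal.rpow_natCast, ← ENNReal.rpow_mul, ← ENNReal.rpow_natCast]
      push_cast
      rw [← hp, hq]
      congr 1
      field_simp
    rw [show 2 * Λ * (T * (A ^ (1 / p) * V ^ (1 / q)))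
      = (2 * Λ * T) * ((A ^ (1 / p)) * (V ^ (1 / q))) by ring, mul_pow, mul_pow (A ^ _), e1, e2]
  have hVm0 : V ^ (m + 1) ≠ 0 := pow_ne_zero _ hV0
  have hVmt : V ^ (m + 1) ≠ ⊤ := ENNReal.pow_ne_top hVtop
  have h5 : ‖φ a - φ b‖ₑ ^ (m + 1) ≤ (2 * Λ * T) ^ (m + 1) * A * V⁻¹ := by
    rw [← ENNReal.mul_le_mul_iff_right hVm0 hVmt]
    refine hpow.trans (le_of_eq ?_)
    rw [pow_succ V]
    calc _ = (2 * Λ * T) ^ (m + 1) * (A * V ^ m) * (V * V⁻¹) := by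
          rw [ENNReal.mul_inv_cancel hV0 hVtop, mul_one]
      _ = _ := by ring
  have h6 : V⁻¹ ≤ 2 ^ m * (ENNReal.ofReal (ρ ^ m))⁻¹ := by
    refine (ENNReal.inv_le_inv.2 hV).trans (le_of_eq ?_)
    rw [div_pow, ENNReal.ofReal_div_of_pos (by positivity), ENNReal.inv_div, div_eq_mul_inv]
    · rw [ENNReal.ofReal_pow (by norm_num)]; simp
    · right; exact ENNReal.ofReal_ne_top
    · left; rw [ne_eq, ENNReal.ofReal_eq_zero]; push Not; positivity
  calc _ ≤ (2 * Λ * T) ^ (m + 1) * A * V⁻¹ := h5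
    _ ≤ (2 * Λ * T) ^ (m + 1) * A * (2 ^ m * (ENNReal.ofReal (ρ ^ m))⁻¹) := by gcongr
    _ = _ := by simp only [mul_pow]; ring

lemma norm_clm_le_sum {n : ℕ} (A : Euc n →L[ℝ] ℝ) :
    ‖A‖ ≤ ∑ k : Fin n, ‖A (EuclideanSpace.single k 1)‖ := by
  refine A.opNorm_le_bound (Finset.sum_nonneg fun _ _ => norm_nonneg _) fun w => ?_
  have hw : w = ∑ k : Fin n, w k • EuclideanSpace.single k (1:ℝ) := by
    ext i
    simp [Finset.sum_apply, Pi.single_apply]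
  conv_lhs => rw [hw]
  rw [map_sum, Finset.sum_mul]
  refine (norm_sum_le _ _).trans (Finset.sum_le_sum fun k _ => ?_)
  rw [map_smul, norm_smul, mul_comm]
  gcongr
  exact PiLp.norm_apply_le w k

/-- Convolution against a probability density does not increase the `L^n` energy. -/
lemma lintegral_conv_pow_le {n : ℕ} (hn : 2 ≤ n) {ψ η : Euc n → ℝ≥0∞} (hψ : Measurable ψ)
    (hη : Measurable η) (h1 : ∫⁻ x, η x = 1) :
    ∫⁻ x, (∫⁻ y, ψ y * η (x - y)) ^ n ≤ ∫⁻ y, ψ y ^ n := by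
  have hpt : ∀ x, (∫⁻ y, ψ y * η (x - y)) ^ n ≤ ∫⁻ y, ψ y ^ n * η (x - y) := by
    intro x
    have hηx : Measurable fun y => η (x - y) := hη.comp (by fun_prop)
    set μ : Measure (Euc n) := volume.withDensity (fun y => η (x - y)) with hμ
    have hμ1 : μ univ = 1 := by
      rw [hμ, withDensity_apply _ MeasurableSet.univ, Measure.restrict_univ,
        lintegral_sub_left_eq_self η x, h1]
    have e1 : ∀ F : Euc n → ℝ≥0∞, Measurable F →
        ∫⁻ y, F y * η (x - y) = ∫⁻ y, F y ∂μ := by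
      intro F hF
      rw [hμ, lintegral_withDensity_eq_lintegral_mul _ hηx hF]
      simp only [Pi.mul_apply, mul_comm]
    rw [e1 ψ hψ, e1 _ (hψ.pow_const n)]
    have hpq : (n:ℝ).HolderConjugate (Real.conjExponent n) :=
      Real.HolderConjugate.conjExponent (by exact_mod_cast hn)
    have h := ENNReal.lintegral_mul_le_Lp_mul_Lq μ hpq (f := ψ) (g := fun _ => 1)
      hψ.aemeasurable aemeasurable_const
    simp only [Pi.mul_apply, mul_one, ENNReal.one_rpow, lintegral_const, hμ1] at h
    have h2 := pow_le_pow_left₀ zero_le h n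
    refine h2.trans (le_of_eq ?_)
    rw [← ENNReal.rpow_natCast, ← ENNReal.rpow_mul,
      one_div_mul_cancel (by positivity), ENNReal.rpow_one]
    simp only [ENNReal.rpow_natCast]
  calc ∫⁻ x, (∫⁻ y, ψ y * η (x - y)) ^ n ≤ ∫⁻ x, ∫⁻ y, ψ y ^ n * η (x - y) :=
        lintegral_mono hpt
    _ = ∫⁻ y, ∫⁻ x, ψ y ^ n * η (x - y) := by
        rw [lintegral_lintegral_swap]
        exact (((hψ.comp measurable_snd).pow_const n).mul
          (hη.comp (measurable_fst.sub measurable_snd))).aemeasurable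
    _ = ∫⁻ y, ψ y ^ n := by
        refine lintegral_congr fun y => ?_
        have hm' : Measurable fun x => η (x - y) := hη.comp (measurable_sub_const y)
        rw [lintegral_const_mul _ hm', lintegral_sub_right_eq_self η y, h1, mul_one]

open scoped Convolution in
lemma mollify {n : ℕ} (hn : 2 ≤ n) {Ω : Set (Euc n)} (hΩ : IsOpen Ω) (hΩv : volume Ω ≠ ⊤)
    {u : Euc n → ℝ} (hu : ContinuousOn u Ω) (hu1 : ∀ x ∈ Ω, ‖u x‖ ≤ 1)
    {g : Fin n → Euc n → ℝ} (hg : ∀ k, LocallyIntegrableOn (g k) Ω volume)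
    (parts : ∀ φ : Euc n → ℝ, ContDiff ℝ ((⊤ : ℕ∞) : WithTop ℕ∞) φ → HasCompactSupport φ →
      tsupport φ ⊆ Ω → ∀ k : Fin n,
      ∫ x in Ω, u x * fderiv ℝ φ x (EuclideanSpace.single k 1) = - ∫ x in Ω, g k x * φ x)
    (hE : ∫⁻ x in Ω, (∑ k, ‖g k x‖ₑ) ^ n ≠ ⊤) :
    ∃ (v : ℕ → Euc n → ℝ) (G : ℕ → Euc n → ℝ≥0∞),
      (∀ j, ContDiff ℝ 1 (v j)) ∧ (∀ j, Measurable (G j)) ∧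
      (∀ x ∈ Ω, Tendsto (fun j => v j x) atTop (𝓝 (u x))) ∧
      (∀ K ⊆ Ω, IsCompact K → ∀ᶠ j in atTop, ∀ x ∈ K, ‖fderiv ℝ (v j) x‖ₑ ≤ G j x) ∧
      ∃ E : ℝ≥0∞, E ≠ ⊤ ∧ ∀ j, ∫⁻ x, G j x ^ n ≤ E := by
  -- the bump functions
  let B : ℕ → ContDiffBump (0 : Euc n) := fun j =>
    ⟨1 / (2 * ((j:ℝ) + 1)), 1 / ((j:ℝ) + 1), by positivity, by
      apply one_div_lt_one_div_of_lt <;> nlinarith [(Nat.cast_nonneg j : (0:ℝ) ≤ j)]⟩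
  have hBr : Tendsto (fun j => (B j).rOut) atTop (𝓝 0) := tendsto_one_div_add_atTop_nhds_zero_nat
  let η : ℕ → Euc n → ℝ := fun j => (B j).normed volume
  have hηc : ∀ j, ContDiff ℝ ((⊤ : ℕ∞) : WithTop ℕ∞) (η j) := fun j => (B j).contDiff_normed
  have hηs : ∀ j, HasCompactSupport (η j) := fun j => (B j).hasCompactSupport_normed
  have hη0 : ∀ j x, 0 ≤ η j x := fun j x => (B j).nonneg_normed x
  have hηm : ∀ j, Measurable fun x => ENNReal.ofReal (η j x) := fun j =>
    (hηc j).continuous.measurable.ennreal_ofReal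
  have hη1 : ∀ j, ∫⁻ x, ENNReal.ofReal (η j x) = 1 := by
    intro j
    rw [← ofReal_integral_eq_lintegral_ofReal (B j).integrable_normed
      (Eventually.of_forall (hη0 j)), (B j).integral_normed, ENNReal.ofReal_one]
  -- extension of `u` by zero
  set w : Euc n → ℝ := Ω.indicator u with hw
  have hwi : Integrable w := by
    rw [hw, integrable_indicator_iff hΩ.measurableSet]
    have : IsFiniteMeasure (volume.restrict Ω) := ⟨by
      rw [Measure.restrict_apply_univ]; exact hΩv.lt_top⟩
    exact Integrable.of_bound (hu.aestronglyMeasurable hΩ.measurableSet) 1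
      (by filter_upwards [ae_restrict_mem hΩ.measurableSet] with x hx using hu1 x hx)
  have hwl : LocallyIntegrable w := hwi.locallyIntegrable
  -- measurable majorant of the gradient
  have hgm : ∀ k, AEMeasurable (fun x => ‖g k x‖ₑ) (volume.restrict Ω) := fun k =>
    (hg k).aestronglyMeasurable.enorm
  set ψ0 : Euc n → ℝ≥0∞ := Ω.indicator fun x => ∑ k, ‖g k x‖ₑ with hψ0
  have hψ0m : AEMeasurable ψ0 := by
    rw [hψ0, aemeasurable_indicator_iff hΩ.measurableSet]
    exact Finset.aemeasurable_fun_sum _ fun k _ => hgm k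
  set ψ := hψ0m.mk ψ0 with hψ
  have hψm : Measurable ψ := hψ0m.measurable_mk
  have hψe : ψ0 =ᵐ[volume] ψ := hψ0m.ae_eq_mk
  have hψE : ∫⁻ x, ψ x ^ n ≠ ⊤ := by
    have : ∫⁻ x, ψ x ^ n = ∫⁻ x in Ω, (∑ k, ‖g k x‖ₑ) ^ n := by
      rw [← lintegral_indicator hΩ.measurableSet]
      refine lintegral_congr_ae ?_
      filter_upwards [hψe] with x hx
      rw [← hx, hψ0]
      by_cases hxΩ : x ∈ Ω
      · simp [hxΩ]
      · simp only [indicator_of_notMem hxΩ]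
        exact zero_pow (by omega)
    rwa [this]
  refine ⟨fun j => w ⋆[ContinuousLinearMap.lsmul ℝ ℝ, volume] η j,
    fun j x => ∫⁻ y, ψ y * ENNReal.ofReal (η j (x - y)), fun j => ?_, fun j => ?_, ?_, ?_,
    ∫⁻ x, ψ x ^ n, hψE, fun j => lintegral_conv_pow_le hn hψm (hηm j) (hη1 j)⟩
  · exact_mod_cast (hηs j).contDiff_convolution_right (n := 1)
      (ContinuousLinearMap.lsmul ℝ ℝ) hwl ((hηc j).of_le (by exact_mod_cast le_top))
  · apply Measurable.lintegral_prod_right' (f := fun p : Euc n × Euc n =>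
      ψ p.2 * ENNReal.ofReal (η j (p.1 - p.2)))
    exact (hψm.comp measurable_snd).mul ((hηm j).comp (measurable_fst.sub measurable_snd))
  · intro x hx
    have hflip : (ContinuousLinearMap.lsmul ℝ ℝ : ℝ →L[ℝ] ℝ →L[ℝ] ℝ).flip
        = ContinuousLinearMap.lsmul ℝ ℝ := by ext; simp
    have hc : Tendsto w (𝓝 x) (𝓝 (u x)) := by
      have h1 : w =ᶠ[𝓝 x] u := by
        filter_upwards [hΩ.mem_nhds hx] with y hy using indicator_of_mem hy u
      exact (tendsto_congr' h1).2 (hu.continuousAt (hΩ.mem_nhds hx))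
    have := ContDiffBump.convolution_tendsto_right (μ := volume) (φ := B) (g := fun _ => w)
      (k := fun _ => x) (x₀ := x) (z₀ := u x) hBr
      (Eventually.of_forall fun _ => hwi.aestronglyMeasurable)
      (hc.comp tendsto_snd) tendsto_const_nhds
    refine this.congr fun j => ?_
    rw [← convolution_flip, hflip]
  · intro K hKΩ hK
    obtain ⟨δ, hδ0, hδ⟩ := hK.exists_cthickening_subset_open hΩ hKΩ
    filter_upwards [hBr.eventually (gt_mem_nhds hδ0)] with j hj x hx
    have hball : closedBall x (B j).rOut ⊆ Ω := fun y hy =>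
      hδ (closedBall_subset_cthickening hx δ (closedBall_subset_closedBall hj.le hy))
    -- the test function
    set φ : Euc n → ℝ := fun y => η j (x - y) with hφ
    have hφc : ContDiff ℝ ((⊤ : ℕ∞) : WithTop ℕ∞) φ :=
      (hηc j).comp (contDiff_const.sub contDiff_id)
    have hφt : tsupport φ ⊆ closedBall x (B j).rOut := by
      refine closure_minimal ?_ isClosed_closedBall
      intro y hy
      have : x - y ∈ Function.support (η j) := hy
      rw [(B j).support_normed_eq, mem_ball_zero_iff] at this
      rw [mem_closedBall, dist_comm, dist_eq_norm]
      exact this.le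
    have hφs : HasCompactSupport φ :=
      (isCompact_closedBall x _).of_isClosed_subset (isClosed_tsupport _) hφt
    have hder : ∀ y e, fderiv ℝ φ y e = - fderiv ℝ (η j) (x - y) e := by
      intro y e
      have h1 : HasFDerivAt φ ((fderiv ℝ (η j) (x - y)).comp
          (-(ContinuousLinearMap.id ℝ (Euc n)))) y := by
        have ha : HasFDerivAt (η j) (fderiv ℝ (η j) (x - y)) (x - y) :=
          ((hηc j).differentiable (by simp) _).hasFDerivAt
        exact ha.comp y ((hasFDerivAt_id y).const_sub x)
      rw [h1.fderiv]
      simp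
    have hfd := (hηs j).hasFDerivAt_convolution_right (ContinuousLinearMap.lsmul ℝ ℝ) hwl
      ((hηc j).of_le (by exact_mod_cast le_top)) x
    have hcomp : ∀ k, fderiv ℝ (w ⋆[ContinuousLinearMap.lsmul ℝ ℝ, volume] η j) x
        (EuclideanSpace.single k 1) = ∫ y in Ω, g k y * φ y := by
      intro k
      rw [hfd.fderiv, convolution_precompR_apply _ hwl ((hηs j).fderiv ℝ)
        ((hηc j).continuous_fderiv (by simp)), convolution_def]
      have h2 := parts φ hφc hφs (hφt.trans hball) k
      have h3 : ∫ y, (ContinuousLinearMap.lsmul ℝ ℝ) (w y)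
          (fderiv ℝ (η j) (x - y) (EuclideanSpace.single k 1))
          = - ∫ y in Ω, u y * fderiv ℝ φ y (EuclideanSpace.single k 1) := by
        rw [← integral_indicator hΩ.measurableSet, ← integral_neg]
        refine integral_congr_ae (Eventually.of_forall fun y => ?_)
        by_cases hy : y ∈ Ω
        · simp [hw, hy, hder]
        · simp [hw, hy]
      rw [h3, h2, neg_neg]
    calc ‖fderiv ℝ (w ⋆[ContinuousLinearMap.lsmul ℝ ℝ, volume] η j) x‖ₑ
        ≤ ∑ k, ‖∫ y in Ω, g k y * φ y‖ₑ := by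
          have h4 := norm_clm_le_sum (fderiv ℝ (w ⋆[ContinuousLinearMap.lsmul ℝ ℝ, volume] η j) x)
          simp only [hcomp] at h4
          rw [← ofReal_norm]
          refine (ENNReal.ofReal_le_ofReal h4).trans ?_
          rw [ENNReal.ofReal_sum_of_nonneg (fun _ _ => norm_nonneg _)]
          simp only [ofReal_norm, le_refl]
      _ ≤ ∑ k, ∫⁻ y in Ω, ‖g k y‖ₑ * ENNReal.ofReal (η j (x - y)) := by
          refine Finset.sum_le_sum fun k _ => (enorm_integral_le_lintegral_enorm _).trans ?_
          refine lintegral_mono fun y => le_of_eq ?_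
          rw [enorm_mul, Real.enorm_of_nonneg (hη0 j _)]
      _ = ∫⁻ y in Ω, (∑ k, ‖g k y‖ₑ) * ENNReal.ofReal (η j (x - y)) := by
          rw [← lintegral_finsetSum']
          · simp only [Finset.sum_mul]
          · intro k _
            exact (hgm k).mul ((hηm j).comp (by fun_prop)).aemeasurable
      _ = ∫⁻ y, ψ0 y * ENNReal.ofReal (η j (x - y)) := by
          rw [← lintegral_indicator hΩ.measurableSet]
          refine lintegral_congr fun y => ?_
          by_cases hy : y ∈ Ω
          · simp [hψ0, hy]
          · simp [hψ0, hy]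
      _ ≤ ∫⁻ y, ψ y * ENNReal.ofReal (η j (x - y)) := by
          refine le_of_eq (lintegral_congr_ae ?_)
          filter_upwards [hψe] with y hy
          rw [hy]

/-! ### Coordinates and slices -/

/-- The point of `ℝ^{m+1}` with first coordinate `s` and remaining coordinates `y`. -/
def slicePt {m : ℕ} (s : ℝ) (y : Fin m → ℝ) : Euc (m + 1) := WithLp.toLp 2 (Fin.cons s y)

lemma continuous_slicePt {m : ℕ} : Continuous fun q : ℝ × (Fin m → ℝ) => slicePt q.1 q.2 := by
  unfold slicePt
  refine (PiLp.continuous_toLp 2 _).comp ?_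
  refine continuous_pi fun i => ?_
  refine Fin.cases ?_ (fun i => ?_) i
  · simpa using continuous_fst
  · simp only [Fin.cons_succ]
    fun_prop

lemma norm_le_sum_euc {n : ℕ} (x : Euc n) : ‖x‖ ≤ ∑ i, ‖x i‖ := by
  have hw : x = ∑ k : Fin n, x k • EuclideanSpace.single k (1:ℝ) := by
    ext i
    simp [Finset.sum_apply, Pi.single_apply]
  conv_lhs => rw [hw]
  refine (norm_sum_le _ _).trans (Finset.sum_le_sum fun k _ => ?_)
  rw [norm_smul]; simp

lemma dist_slicePt_le {m : ℕ} (s s' : ℝ) (y y' : Fin m → ℝ) :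
    dist (slicePt s y) (slicePt s' y') ≤ dist s s' + m * dist y y' := by
  rw [dist_eq_norm]
  refine (norm_le_sum_euc _).trans ?_
  rw [Fin.sum_univ_succ]
  simp only [slicePt, PiLp.sub_apply, Fin.cons_zero, Fin.cons_succ]
  refine add_le_add (le_of_eq (dist_eq_norm s s').symm) ?_
  calc ∑ i : Fin m, ‖y i - y' i‖ ≤ ∑ _i : Fin m, dist y y' :=
        Finset.sum_le_sum fun i _ => by rw [← dist_eq_norm]; exact dist_le_pi_dist y y' i
    _ = _ := by simp

lemma lintegral_slices {m : ℕ} (R : Euc (m + 1) ≃ₗᵢ[ℝ] Euc (m + 1)) {ψ : (Fin m → ℝ) → ℝ}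
    (hψ : Continuous ψ) {F : Euc (m + 1) → ℝ≥0∞} (hF : Measurable F) :
    ∫⁻ t, ∫⁻ y, F (R (slicePt (ψ y - t) y)) = ∫⁻ x, F x := by
  have hFR : Measurable fun q : ℝ × (Fin m → ℝ) => F (R (slicePt q.1 q.2)) :=
    hF.comp (R.continuous.comp continuous_slicePt).measurable
  rw [lintegral_lintegral_swap]
  · have h1 : ∀ y, ∫⁻ t, F (R (slicePt (ψ y - t) y)) = ∫⁻ t, F (R (slicePt t y)) := fun y =>
      lintegral_sub_left_eq_self (fun t => F (R (slicePt t y))) (ψ y)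
    simp only [h1]
    rw [lintegral_lintegral_swap (f := fun y t => F (R (slicePt t y)))
      (hFR.comp measurable_swap).aemeasurable]
    rw [lintegral_lintegral (f := fun t y => F (R (slicePt t y))) hFR.aemeasurable]
    have hmp := (PiLp.volume_preserving_toLp (Fin (m + 1))).comp
      (volume_preserving_piFinSuccAbove (fun _ : Fin (m + 1) => ℝ) 0).symm
    have hmp2 := R.measurePreserving.comp hmp
    rw [← hmp2.lintegral_comp hF]
    refine lintegral_congr fun q => ?_
    have hq : slicePt q.1 q.2 = WithLp.toLp 2
        ((MeasurableEquiv.piFinSuccAbove (fun _ : Fin (m + 1) => ℝ) 0).symm q) := by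
      unfold slicePt
      congr 1
      exact (Fin.insertNth_zero' q.1 q.2).symm
    rw [hq]
    rfl
  · refine (hFR.comp (Measurable.prodMk ?_ measurable_snd)).aemeasurable
    exact (hψ.measurable.comp measurable_snd).sub measurable_fst

lemma slices {m : ℕ} (hm : 1 ≤ m) (R : Euc (m + 1) ≃ₗᵢ[ℝ] Euc (m + 1)) {ψ : (Fin m → ℝ) → ℝ}
    (hψ : Continuous ψ) {Ω : Set (Euc (m + 1))} (hΩ : IsOpen Ω) (hΩv : volume Ω ≠ ⊤)
    {u : Euc (m + 1) → ℝ} (hu : ContinuousOn u Ω) (hu1 : ∀ x ∈ Ω, ‖u x‖ ≤ 1)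
    {g : Fin (m + 1) → Euc (m + 1) → ℝ} (hg : ∀ k, LocallyIntegrableOn (g k) Ω volume)
    (parts : ∀ φ : Euc (m + 1) → ℝ, ContDiff ℝ ((⊤ : ℕ∞) : WithTop ℕ∞) φ → HasCompactSupport φ →
      tsupport φ ⊆ Ω → ∀ k : Fin (m + 1),
      ∫ x in Ω, u x * fderiv ℝ φ x (EuclideanSpace.single k 1) = - ∫ x in Ω, g k x * φ x)
    (hE : ∫⁻ x in Ω, (∑ k, ‖g k x‖ₑ) ^ (m + 1) ≠ ⊤) :
    ∃ e : ℝ → ℝ≥0∞, Measurable e ∧ ∫⁻ t, e t ≠ ⊤ ∧ ∀ L : ℝ≥0, ∃ C : ℝ≥0∞, C ≠ ⊤ ∧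
      ∀ (t ρ : ℝ) (S : Set (Fin m → ℝ)) (K : Set (Euc (m + 1))), 0 < ρ → Convex ℝ S →
        MeasurableSet S → S ⊆ ball 0 ρ → ENNReal.ofReal ((ρ / 2) ^ m) ≤ volume S →
        LipschitzOnWith L ψ S → K ⊆ Ω → IsCompact K →
        (∀ y ∈ S, R (slicePt (ψ y - t) y) ∈ K) →
        ∀ a ∈ S, ∀ b ∈ S,
          ‖u (R (slicePt (ψ a - t) a)) - u (R (slicePt (ψ b - t) b))‖ₑ ^ (m + 1) ≤
            C * ENNReal.ofReal ρ * e t := by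
  obtain ⟨v, G, hv, hG, hlim, hK, E, hEt, hGE⟩ :=
    mollify (by omega) hΩ hΩv hu hu1 hg parts hE
  let P : ℝ → (Fin m → ℝ) → Euc (m + 1) := fun t y => R (slicePt (ψ y - t) y)
  have hPc : Continuous fun q : ℝ × (Fin m → ℝ) => P q.1 q.2 :=
    R.continuous.comp (continuous_slicePt.comp
      (((hψ.comp continuous_snd).sub continuous_fst).prodMk continuous_snd))
  let e : ℕ → ℝ → ℝ≥0∞ := fun j t => ∫⁻ y, G j (P t y) ^ (m + 1)
  have hem : ∀ j, Measurable (e j) := fun j =>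
    Measurable.lintegral_prod_right' (f := fun q : ℝ × (Fin m → ℝ) => G j (P q.1 q.2) ^ (m + 1))
      (((hG j).comp hPc.measurable).pow_const _)
  have heE : ∀ j, ∫⁻ t, e j t ≤ E := fun j =>
    (le_of_eq (lintegral_slices R hψ ((hG j).pow_const (m + 1)))).trans (hGE j)
  refine ⟨fun t => liminf (fun j => e j t) atTop, Measurable.liminf hem, ?_, ?_⟩
  · refine ((lintegral_liminf_le hem).trans ?_).trans_lt hEt.lt_top |>.ne
    refine (liminf_le_liminf (Eventually.of_forall heE)).trans ?_
    simp
  intro L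
  obtain ⟨C, hC, hmor⟩ := morrey m hm
  refine ⟨C * ENNReal.ofReal (2 * (L + m)) ^ (m + 1), by finiteness, ?_⟩
  intro t ρ S K hρ hSc hSm hSb hSv hL hKΩ hKc hSK a ha b hb
  change ‖u (P t a) - u (P t b)‖ₑ ^ (m + 1) ≤ _
  have hPt : Continuous (P t) := hPc.comp (Continuous.prodMk_right t)
  have hLP : ∀ y ∈ S, ∀ y' ∈ S, dist (P t y) (P t y') ≤ (L + m) * dist y y' := by
    intro y hy y' hy'
    simp only [P, R.dist_map]
    refine (dist_slicePt_le _ _ _ _).trans ?_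
    rw [dist_sub_right, add_mul]
    gcongr
    exact hL.dist_le_mul y hy y' hy'
  have hev : ∀ᶠ j in atTop, ‖v j (P t a) - v j (P t b)‖ₑ ^ (m + 1) ≤
      C * ENNReal.ofReal (2 * (L + m)) ^ (m + 1) * ENNReal.ofReal ρ * e j t := by
    filter_upwards [hK K hKΩ hKc] with j hj
    set Λ : ℝ≥0 := Real.toNNReal ((L + m) * (2 * ρ)) with hΛ
    have hΛr : (Λ : ℝ) = (L + m) * (2 * ρ) := Real.coe_toNNReal _ (by positivity)
    have h1 := hmor ρ hρ S hSc hSm hSb hSv (fun y => ‖fderiv ℝ (v j) (P t y)‖ₑ)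
      ((((hv j).continuous_fderiv one_ne_zero).comp hPt).measurable.enorm)
      (fun y => v j (P t y)) Λ ENNReal.coe_ne_top ?_ a ha b hb
    · refine h1.trans ?_
      have h2 : ∫⁻ z in S, ‖fderiv ℝ (v j) (P t z)‖ₑ ^ (m + 1) ≤ e j t := by
        refine le_trans (setLIntegral_mono (((hG j).comp hPt.measurable).pow_const (m + 1))
          fun y hy => ?_) (setLIntegral_le_lintegral S _)
        exact pow_le_pow_left₀ zero_le (hj _ (hSK y hy)) _
      have h3 : C * (Λ:ℝ≥0∞) ^ (m + 1) * (ENNReal.ofReal (ρ ^ m))⁻¹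
          = C * ENNReal.ofReal (2 * (L + m)) ^ (m + 1) * ENNReal.ofReal ρ := by
        have : (Λ : ℝ≥0∞) = ENNReal.ofReal (2 * (L + m)) * ENNReal.ofReal ρ := by
          rw [← ENNReal.ofReal_mul (by positivity), hΛ]
          change ENNReal.ofReal _ = _
          congr 1; ring
        have hr0 : ENNReal.ofReal ρ ^ m ≠ 0 := pow_ne_zero _ (by simpa using hρ)
        rw [this, mul_pow, pow_succ (ENNReal.ofReal ρ), ENNReal.ofReal_pow hρ.le]
        calc _ = C * ENNReal.ofReal (2 * (L + m)) ^ (m + 1) * ENNReal.ofReal ρ *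
              (ENNReal.ofReal ρ ^ m * (ENNReal.ofReal ρ ^ m)⁻¹) := by ring
          _ = _ := by rw [ENNReal.mul_inv_cancel hr0 (by finiteness), mul_one]
      rw [h3]
      gcongr
    · intro y hy z hz
      have h4 := curve_bound (hv j) (γ := fun τ => P t (y + τ • (z - y))) (L := Λ)
        (hPt.comp (by fun_prop)) ?_
      · simp only [one_smul, zero_smul, add_zero, add_sub_cancel] at h4
        rw [enorm_sub_rev]
        exact h4
      · refine LipschitzOnWith.of_dist_le_mul fun τ hτ τ' hτ' => ?_
        have m1 := hSc.add_smul_sub_mem hy hz hτ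
        have m2 := hSc.add_smul_sub_mem hy hz hτ'
        refine (hLP _ m1 _ m2).trans ?_
        rw [hΛr, mul_assoc]
        gcongr
        rw [dist_add_left, dist_eq_norm, ← sub_smul, norm_smul, mul_comm, dist_eq_norm]
        gcongr
        have b1 := mem_ball_zero_iff.1 (hSb hy)
        have b2 := mem_ball_zero_iff.1 (hSb hz)
        linarith [norm_sub_le z y]
  have htl : Tendsto (fun j => ‖v j (P t a) - v j (P t b)‖ₑ ^ (m + 1)) atTop
      (𝓝 (‖u (P t a) - u (P t b)‖ₑ ^ (m + 1))) := by
    refine ((ENNReal.continuous_pow (m + 1)).tendsto _).comp ?_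
    exact ((hlim _ (hKΩ (hSK a ha))).sub (hlim _ (hKΩ (hSK b hb)))).enorm
  rw [← htl.liminf_eq]
  refine (liminf_le_liminf hev).trans (le_of_eq ?_)
  exact ENNReal.liminf_const_mul_of_ne_top (by finiteness)

/-! ### Energy and coordinates -/

lemma entry_le_opNorm {n : ℕ} (M : Matrix (Fin n) (Fin n) ℝ) (i k : Fin n) :
    ‖M i k‖ ≤ opNorm M := by
  have h1 := (LinearMap.toContinuousLinearMap (Matrix.toEuclideanLin M)).le_opNorm
    (EuclideanSpace.single k (1 : ℝ))
  have h2 := PiLp.norm_apply_le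
    ((LinearMap.toContinuousLinearMap (Matrix.toEuclideanLin M)) (EuclideanSpace.single k (1 : ℝ))) i
  have h3 : ((LinearMap.toContinuousLinearMap (Matrix.toEuclideanLin M))
      (EuclideanSpace.single k (1 : ℝ))) i = M i k := by
    simp [Matrix.toLpLin_apply]
  rw [h3] at h2
  refine h2.trans (h1.trans ?_)
  simp [opNorm]

lemma energy_ne_top {m : ℕ} {Ω : Set (Euc (m + 1))}
    {Dg : Euc (m + 1) → Matrix (Fin (m + 1)) (Fin (m + 1)) ℝ}
    (lp : IntegrableOn (fun x => opNorm (Dg x) ^ ((m + 1 : ℕ) : ℝ)) Ω volume) (i : Fin (m + 1)) :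
    ∫⁻ x in Ω, (∑ k, ‖Dg x i k‖ₑ) ^ (m + 1) ≠ ⊤ := by
  have h1 : ∀ x, (∑ k, ‖Dg x i k‖ₑ) ^ (m + 1) ≤
      ((m + 1 : ℕ) : ℝ≥0∞) ^ (m + 1) * ‖opNorm (Dg x) ^ ((m + 1 : ℕ) : ℝ)‖ₑ := by
    intro x
    have h0 : 0 ≤ opNorm (Dg x) := norm_nonneg _
    rw [Real.rpow_natCast, enorm_pow, ← mul_pow]
    gcongr
    calc ∑ k, ‖Dg x i k‖ₑ ≤ ∑ _k : Fin (m + 1), ‖opNorm (Dg x)‖ₑ := by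
          refine Finset.sum_le_sum fun k _ => ?_
          rw [enorm_le_iff_norm_le, Real.norm_of_nonneg h0]
          exact entry_le_opNorm _ _ _
      _ = _ := by simp
  refine ne_top_of_le_ne_top ?_ (lintegral_mono h1)
  rw [lintegral_const_mul' _ _ (by finiteness)]
  exact ENNReal.mul_ne_top (by finiteness) lp.hasFiniteIntegral.ne

@[simp] lemma slicePt_zero {m : ℕ} (s : ℝ) (y : Fin m → ℝ) : slicePt s y 0 = s := rfl

@[simp] lemma slicePt_succ {m : ℕ} (s : ℝ) (y : Fin m → ℝ) (i : Fin m) :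
    slicePt s y i.succ = y i := rfl

lemma slicePt_eta {m : ℕ} (x : Euc (m + 1)) : slicePt (x 0) (fun i => x i.succ) = x := by
  ext i
  refine Fin.cases rfl (fun i => rfl) i

lemma slicePt_zero_zero {m : ℕ} : slicePt (m := m) 0 0 = 0 := by
  ext i
  refine Fin.cases rfl (fun i => rfl) i

lemma norm_slicePt_le {m : ℕ} (s : ℝ) (y : Fin m → ℝ) : ‖slicePt s y‖ ≤ |s| + m * ‖y‖ := by
  have := dist_slicePt_le s 0 y 0
  rw [slicePt_zero_zero, dist_zero_right, dist_zero_right, dist_zero_right] at this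
  simpa using this

lemma norm_slicePt_sq {m : ℕ} (s : ℝ) (y : Fin m → ℝ) :
    ‖slicePt s y‖ ^ 2 = s ^ 2 + ∑ i, y i ^ 2 := by
  rw [EuclideanSpace.norm_sq_eq, Fin.sum_univ_succ]
  simp

lemma slicePt_notMem_slit {m : ℕ} (s : ℝ) {y : Fin m → ℝ} (hy : y ≠ 0) :
    slicePt s y ∉ slit (m + 1) := by
  intro h
  refine hy (funext fun i => ?_)
  exact h.2.2 i.succ (Fin.succ_ne_zero i)

lemma mem_slit_iff {m : ℕ} {x : Euc (m + 1)} (hx : ‖x‖ < 1) :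
    x ∈ slit (m + 1) ↔ 0 ≤ x 0 ∧ (fun i : Fin m => x i.succ) = 0 := by
  constructor
  · intro h
    exact ⟨h.1, funext fun i => h.2.2 i.succ (Fin.succ_ne_zero i)⟩
  · rintro ⟨h1, h2⟩
    refine ⟨h1, ?_, ?_⟩
    · exact lt_of_le_of_lt ((le_abs_self _).trans (PiLp.norm_apply_le x 0)) hx
    · intro i hi
      obtain ⟨j, rfl⟩ := Fin.exists_succ_eq.2 hi
      exact congrFun h2 j

lemma isOpen_slitBall {m : ℕ} : IsOpen (unitBall (m + 1) \ slit (m + 1)) := by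
  have hc : IsClosed {x : Euc (m + 1) | 0 ≤ x 0 ∧ (fun i : Fin m => x i.succ) = 0} := by
    have h1 : Continuous fun x : Euc (m + 1) => x 0 := by fun_prop
    have h2 : Continuous fun x : Euc (m + 1) => fun i : Fin m => x i.succ := by fun_prop
    exact (isClosed_le continuous_const h1).inter (isClosed_eq h2 continuous_const)
  have : unitBall (m + 1) \ slit (m + 1) =
      ball 0 1 ∩ {x : Euc (m + 1) | 0 ≤ x 0 ∧ (fun i : Fin m => x i.succ) = 0}ᶜ := by
    ext x
    constructor
    · rintro ⟨h1, h2⟩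
      exact ⟨h1, fun h => h2 ((mem_slit_iff (by simpa [unitBall] using h1)).2 h)⟩
    · rintro ⟨h1, h2⟩
      exact ⟨h1, fun h => h2 ((mem_slit_iff (by simpa [unitBall] using h1)).1 h)⟩
  rw [this]
  exact isOpen_ball.inter hc.isOpen_compl

/-! ### The inverse map has a limit along almost every slice -/

lemma half_cube {m : ℕ} {ρ δ : ℝ} (hρ : 0 < ρ) (hδ : δ < ρ / 2) (j : Fin m) {σ : ℝ}
    (hσ : σ = 1 ∨ σ = -1) :
    ENNReal.ofReal ((ρ / 2) ^ m) ≤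
      volume (ball (0 : Fin m → ℝ) ρ ∩ {y | δ < σ * y j}) := by
  have hσ1 : |σ| = 1 := by rcases hσ with rfl | rfl <;> simp
  have hσ2 : σ * σ = 1 := by rcases hσ with rfl | rfl <;> simp
  have h1 : volume (ball (Pi.single j (3 / 4 * ρ * σ) : Fin m → ℝ) (ρ / 4)) =
      ENNReal.ofReal ((ρ / 2) ^ m) := by
    rw [Real.volume_pi_ball _ (by positivity)]
    simp only [Fintype.card_fin]
    congr 2; ring
  rw [← h1]
  refine measure_mono fun y hy => ⟨?_, ?_⟩
  · rw [mem_ball_zero_iff]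
    have h2 : ‖(Pi.single j (3 / 4 * ρ * σ) : Fin m → ℝ)‖ = 3 / 4 * ρ := by
      rw [Pi.norm_single, norm_mul, Real.norm_eq_abs σ, hσ1, mul_one, Real.norm_of_nonneg]
      positivity
    have h3 := norm_le_norm_add_norm_sub' y (Pi.single j (3 / 4 * ρ * σ))
    rw [mem_ball, dist_eq_norm] at hy
    linarith
  · have h2 : |y j - 3 / 4 * ρ * σ| < ρ / 4 := by
      have := (dist_le_pi_dist y (Pi.single j (3 / 4 * ρ * σ)) j).trans_lt hy
      simpa [Real.dist_eq] using this
    have h3 : |σ * y j - 3 / 4 * ρ| < ρ / 4 := by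
      have : σ * y j - 3 / 4 * ρ = σ * (y j - 3 / 4 * ρ * σ) := by linear_combination (3/4*ρ) * hσ2
      rw [this, abs_mul, hσ1, one_mul]; exact h2
    have := (abs_lt.1 h3).1
    change δ < σ * y j
    linarith

lemma link {m : ℕ} (hm : 2 ≤ m) {ρ ε : ℝ} (hρ : 0 < ρ) (w : (Fin m → ℝ) → ℝ)
    (H : ∀ (j : Fin m) (σ : ℝ), (σ = 1 ∨ σ = -1) → ∀ a ∈ ball (0 : Fin m → ℝ) ρ,
      ∀ b ∈ ball (0 : Fin m → ℝ) ρ, 0 < σ * a j → 0 < σ * b j → |w a - w b| ≤ ε) :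
    ∀ a ∈ ball (0 : Fin m → ℝ) ρ, ∀ b ∈ ball (0 : Fin m → ℝ) ρ, a ≠ 0 → b ≠ 0 →
      |w a - w b| ≤ 4 * ε := by
  have sgn : ∀ x : ℝ, x ≠ 0 → ∃ σ : ℝ, (σ = 1 ∨ σ = -1) ∧ 0 < σ * x := by
    intro x hx
    rcases lt_or_gt_of_ne hx with h | h
    · exact ⟨-1, Or.inr rfl, by linarith⟩
    · exact ⟨1, Or.inl rfl, by linarith⟩
  have two : ∀ a ∈ ball (0 : Fin m → ℝ) ρ, ∀ b ∈ ball (0 : Fin m → ℝ) ρ, ∀ j k : Fin m, j ≠ k →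
      a j ≠ 0 → b k ≠ 0 → |w a - w b| ≤ 2 * ε := by
    intro a ha b hb j k hjk haj hbk
    obtain ⟨σ, hσ, hσa⟩ := sgn _ haj
    obtain ⟨τ, hτ, hτb⟩ := sgn _ hbk
    have hσ2 : σ * σ = 1 := by rcases hσ with rfl | rfl <;> simp
    have hτ2 : τ * τ = 1 := by rcases hτ with rfl | rfl <;> simp
    let c : Fin m → ℝ := fun i => if i = j then σ * (ρ / 2) else if i = k then τ * (ρ / 2) else 0
    have hcj : c j = σ * (ρ / 2) := by simp [c]
    have hck : c k = τ * (ρ / 2) := by simp [c, hjk.symm]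
    have hc : c ∈ ball (0 : Fin m → ℝ) ρ := by
      rw [mem_ball_zero_iff, pi_norm_lt_iff hρ]
      intro i
      simp only [c]
      have h1 : |ρ| / 2 < ρ := by rw [abs_of_pos hρ]; linarith
      split_ifs
      · rcases hσ with rfl | rfl <;> simpa using h1
      · rcases hτ with rfl | rfl <;> simpa using h1
      · simpa using hρ
    have h1 := H j σ hσ a ha c hc hσa (by rw [hcj, ← mul_assoc, hσ2]; linarith)
    have h2 := H k τ hτ c hc b hb (by rw [hck, ← mul_assoc, hτ2]; linarith) hτb
    have := abs_sub_le (w a) (w c) (w b)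
    linarith
  intro a ha b hb ha0 hb0
  obtain ⟨j, hj⟩ := Function.ne_iff.1 ha0
  obtain ⟨k, hk⟩ := Function.ne_iff.1 hb0
  simp only [Pi.zero_apply] at hj hk
  have : Nontrivial (Fin m) := Fin.nontrivial_iff_two_le.2 hm
  by_cases hjk : j = k
  · subst hjk
    obtain ⟨j', hj'⟩ := exists_ne j
    let c : Fin m → ℝ := Pi.single j' (ρ / 2)
    have hc : c ∈ ball (0 : Fin m → ℝ) ρ := by
      rw [mem_ball_zero_iff, Pi.norm_single, Real.norm_of_nonneg (by positivity)]; linarith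
    have hcj : c j' ≠ 0 := by simp [c]; positivity
    have h1 := two a ha c hc j j' hj'.symm hj hcj
    have h2 := two c hc b hb j' j hj' hcj hk
    have := abs_sub_le (w a) (w c) (w b)
    linarith
  · have h1 := two a ha b hb j k hjk hj hk
    have h2 := abs_nonneg (w a - w b)
    linarith

lemma stepA {m : ℕ} (hm : 2 ≤ m) {f : Euc (m + 1) → Euc (m + 1)}
    {Df : Euc (m + 1) → Matrix (Fin (m + 1)) (Fin (m + 1)) ℝ}
    (hf : ContinuousOn f (unitBall (m + 1) \ slit (m + 1)))
    (hmaps : MapsTo f (unitBall (m + 1) \ slit (m + 1)) (unitBall (m + 1)))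
    (hS : MemSobolev ((m + 1 : ℕ) : ℝ) (unitBall (m + 1) \ slit (m + 1)) f Df) :
    ∃ t : ℝ, 0 < t ∧ t < 1 / 2 ∧ ∃ p, Tendsto (fun y : Fin m → ℝ => f (slicePt t y))
      (𝓝[≠] 0) (𝓝 p) := by
  set Ω := unitBall (m + 1) \ slit (m + 1) with hΩdef
  have hΩv : volume Ω ≠ ⊤ := ne_top_of_le_ne_top
    (measure_ball_lt_top (μ := volume) (x := (0 : Euc (m + 1))) (r := 1)).ne
    (measure_mono sdiff_subset)
  have hsl := fun i : Fin (m + 1) => slices (m := m) (by omega)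
    (LinearIsometryEquiv.refl ℝ (Euc (m + 1))) (ψ := fun _ => 0) continuous_const
    (Ω := Ω) isOpen_slitBall hΩv (u := fun x => f x i) (by fun_prop)
    (fun x hx => (PiLp.norm_apply_le _ i).trans
      (by have := hmaps hx; rw [unitBall, mem_ball_zero_iff] at this; exact this.le))
    (g := fun k x => Df x i k) (fun k => hS.locIntD i k)
    (fun φ h1 h2 h3 k => hS.parts φ h1 h2 h3 i k) (energy_ne_top hS.lp i)
  choose e hem hei hC using hsl
  choose C hCt hest using fun i => hC i 0
  have hae : ∀ᵐ t, ∀ i, e i t < ⊤ := by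
    rw [ae_all_iff]
    exact fun i => ae_lt_top (hem i) (hei i)
  obtain ⟨t', ht', het⟩ := (Measure.dense_of_ae hae).exists_mem_open
    (isOpen_Ioo (a := (-1 / 2 : ℝ)) (b := 0)) ⟨-1/4, by norm_num, by norm_num⟩
  refine ⟨-t', by linarith [het.2], by linarith [het.1], ?_⟩
  have ht1 : |-t'| < 1 / 2 := by rw [abs_lt]; constructor <;> linarith [het.1, het.2]
  have hmpos : (0 : ℝ) < m := by positivity
  -- basic estimate on half cubes
  have half : ∀ i : Fin (m + 1), ∀ ρ : ℝ, 0 < ρ → m * ρ < 1 / 2 → ∀ (j : Fin m) (σ : ℝ),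
      (σ = 1 ∨ σ = -1) → ∀ a ∈ ball (0 : Fin m → ℝ) ρ, ∀ b ∈ ball (0 : Fin m → ℝ) ρ,
      0 < σ * a j → 0 < σ * b j →
      ‖f (slicePt (-t') a) i - f (slicePt (-t') b) i‖ₑ ^ (m + 1) ≤
        C i * ENNReal.ofReal ρ * e i t' := by
    intro i ρ hρ hmρ j σ hσ a ha b hb haj hbj
    obtain ⟨δ, hδ0, hδ⟩ := exists_between (lt_min (lt_min haj hbj) (half_pos hρ))
    have hδa : δ < σ * a j := hδ.trans_le ((min_le_left _ _).trans (min_le_left _ _))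
    have hδb : δ < σ * b j := hδ.trans_le ((min_le_left _ _).trans (min_le_right _ _))
    have hδρ : δ < ρ / 2 := hδ.trans_le (min_le_right _ _)
    have hcont : Continuous fun y : Fin m → ℝ => slicePt (-t') y :=
      continuous_slicePt.comp (continuous_const.prodMk continuous_id)
    have hlin : Continuous fun y : Fin m → ℝ => σ * y j := by fun_prop
    have hconv : Convex ℝ {y : Fin m → ℝ | δ < σ * y j} := by
      refine convex_halfSpace_gt (f := fun y : Fin m → ℝ => σ * y j) ?_ δ
      exact ⟨fun x y => by simp [mul_add], fun c x => by simp; ring⟩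
    have := hest i t' ρ (ball (0 : Fin m → ℝ) ρ ∩ {y | δ < σ * y j})
      ((fun y => slicePt (-t') y) '' (closedBall (0 : Fin m → ℝ) ρ ∩ {y | δ ≤ σ * y j})) hρ
      ((convex_ball _ _).inter hconv)
      (isOpen_ball.inter (isOpen_lt continuous_const hlin)).measurableSet
      inter_subset_left (half_cube hρ hδρ j hσ) (LipschitzWith.const _).lipschitzOnWith
      (by
        rintro _ ⟨y, ⟨hy1, hy2⟩, rfl⟩
        refine ⟨?_, slicePt_notMem_slit _ ?_⟩
        · rw [unitBall, mem_ball_zero_iff]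
          refine (norm_slicePt_le _ _).trans_lt ?_
          rw [mem_closedBall_zero_iff] at hy1
          have := mul_le_mul_of_nonneg_left hy1 hmpos.le
          linarith
        · rintro rfl
          simp only [mem_ofPred_eq, Pi.zero_apply, mul_zero] at hy2
          linarith)
      (((isCompact_closedBall _ _).inter_right (isClosed_le continuous_const hlin)).image hcont)
      (by
        rintro y ⟨hy1, hy2⟩
        refine ⟨y, ⟨ball_subset_closedBall hy1, (show δ < σ * y j from hy2).le⟩, ?_⟩
        simp)
      a ⟨ha, hδa⟩ b ⟨hb, hδb⟩
    simpa using this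
  have small : ∀ ε : ℝ, 0 < ε → ∃ ρ : ℝ, 0 < ρ ∧ m * ρ < 1 / 2 ∧
      ∀ i, C i * ENNReal.ofReal ρ * e i t' < ENNReal.ofReal ε ^ (m + 1) := by
    intro ε hε
    have h1 : ∀ i, ∀ᶠ ρ in 𝓝[>] (0 : ℝ),
        C i * ENNReal.ofReal ρ * e i t' < ENNReal.ofReal ε ^ (m + 1) := by
      intro i
      have h2 : Tendsto (fun ρ : ℝ => C i * ENNReal.ofReal ρ * e i t') (𝓝[>] 0) (𝓝 0) := by
        have h3 : Tendsto (fun ρ : ℝ => ENNReal.ofReal ρ) (𝓝[>] 0) (𝓝 0) := by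
          have := (ENNReal.continuous_ofReal.tendsto 0).mono_left
            (nhdsWithin_le_nhds (s := Ioi (0 : ℝ)))
          simpa using this
        have h4 := ENNReal.Tendsto.const_mul (a := C i * e i t') h3
          (Or.inr (ENNReal.mul_ne_top (hCt i) (ht' i).ne))
        rw [mul_zero] at h4
        refine h4.congr fun ρ => by ring
      refine h2.eventually_lt_const ?_
      have : ENNReal.ofReal ε ≠ 0 := by simpa using hε
      positivity
    have h5 : ∀ᶠ ρ in 𝓝[>] (0 : ℝ), (m : ℝ) * ρ < 1 / 2 := by
      have : Tendsto (fun ρ : ℝ => (m : ℝ) * ρ) (𝓝[>] 0) (𝓝 ((m : ℝ) * 0)) :=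
        ((continuous_const.mul continuous_id).tendsto 0).mono_left nhdsWithin_le_nhds
      exact this.eventually_lt_const (by norm_num)
    obtain ⟨ρ, h6, h7, h8⟩ := ((eventually_all.2 h1).and
      (h5.and self_mem_nhdsWithin)).exists
    exact ⟨ρ, h8, h7, h6⟩
  have cau : ∀ ε : ℝ, 0 < ε → ∃ ρ : ℝ, 0 < ρ ∧ ∀ a ∈ ball (0 : Fin m → ℝ) ρ,
      ∀ b ∈ ball (0 : Fin m → ℝ) ρ, a ≠ 0 → b ≠ 0 → ∀ i,
        |f (slicePt (-t') a) i - f (slicePt (-t') b) i| ≤ 4 * ε := by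
    intro ε hε
    obtain ⟨ρ, hρ, hmρ, h⟩ := small ε hε
    refine ⟨ρ, hρ, fun a ha b hb ha0 hb0 i => ?_⟩
    refine link hm hρ (fun y => f (slicePt (-t') y) i) ?_ a ha b hb ha0 hb0
    intro j σ hσ a ha b hb haj hbj
    have h1 := (half i ρ hρ hmρ j σ hσ a ha b hb haj hbj).trans_lt (h i)
    have h2 := lt_of_pow_lt_pow_left' _ h1
    rw [← ofReal_norm, ENNReal.ofReal_lt_ofReal_iff hε] at h2
    exact h2.le
  have : Nonempty (Fin m) := ⟨⟨0, by omega⟩⟩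
  refine cauchy_map_iff_exists_tendsto.1 (Metric.cauchy_iff.2 ⟨inferInstance, fun ε hε => ?_⟩)
  obtain ⟨ρ, hρ, h⟩ := cau (ε / (8 * (m + 1))) (by positivity)
  refine ⟨(fun y => f (slicePt (-t') y)) '' (ball 0 ρ ∩ {0}ᶜ),
    image_mem_map (inter_comm _ _ ▸ inter_mem_nhdsWithin _ (ball_mem_nhds _ hρ)), ?_⟩
  rintro _ ⟨a, ⟨ha, ha0⟩, rfl⟩ _ ⟨b, ⟨hb, hb0⟩, rfl⟩
  rw [dist_eq_norm]
  refine (norm_le_sum_euc _).trans_lt ?_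
  calc ∑ i, ‖(f (slicePt (-t') a) - f (slicePt (-t') b)) i‖
      ≤ ∑ _i : Fin (m + 1), 4 * (ε / (8 * (m + 1))) :=
        Finset.sum_le_sum fun i _ => h a ha b hb ha0 hb0 i
    _ = ε / 2 := by
      simp only [Finset.sum_const, Finset.card_univ, Fintype.card_fin, nsmul_eq_mul]
      push_cast
      field_simp
      norm_num
    _ < ε := by linarith

/-! ### The modulus estimate at the boundary point -/

lemma not_log_bound {e : ℝ → ℝ≥0∞} (hei : ∫⁻ t, e t ≠ ⊤) {c C : ℝ≥0∞}
    (hc : c ≠ 0) (hct : c ≠ ⊤) (hC : C ≠ ⊤) {r₁ : ℝ} (hr₁ : 0 < r₁)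
    (H : ∀ r, 0 < r → r < r₁ → c ≤ C * ENNReal.ofReal r * e r) : False := by
  have h1 : IntegrableOn (fun r : ℝ => r ^ (-1 : ℝ)) (Ioo 0 r₁) := by
    refine ⟨(measurable_id.pow_const _).aestronglyMeasurable, ?_⟩
    refine lt_of_le_of_lt (setLIntegral_mono_ae' measurableSet_Ioo
      (g := fun r => c⁻¹ * C * e r) (ae_of_all _ ?_)) ?_
    · rintro r ⟨hr0, hr1⟩
      have h2 : ENNReal.ofReal r ≠ 0 := by simpa using hr0
      have h3 : ‖r ^ (-1 : ℝ)‖ₑ = (ENNReal.ofReal r)⁻¹ := by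
        rw [Real.rpow_neg_one, enorm_inv hr0.ne', Real.enorm_eq_ofReal hr0.le]
      rw [h3]
      calc (ENNReal.ofReal r)⁻¹ = c⁻¹ * c * (ENNReal.ofReal r)⁻¹ := by
            rw [ENNReal.inv_mul_cancel hc hct, one_mul]
        _ ≤ c⁻¹ * (C * ENNReal.ofReal r * e r) * (ENNReal.ofReal r)⁻¹ := by
            gcongr
            exact H r hr0 hr1
        _ = c⁻¹ * C * e r * (ENNReal.ofReal r * (ENNReal.ofReal r)⁻¹) := by ring
        _ = c⁻¹ * C * e r := by
            rw [ENNReal.mul_inv_cancel h2 ENNReal.ofReal_ne_top, mul_one]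
    · rw [lintegral_const_mul' _ _ (by finiteness)]
      exact ENNReal.mul_lt_top (by finiteness)
        ((setLIntegral_le_lintegral _ _).trans_lt hei.lt_top)
  rw [intervalIntegral.integrableOn_Ioo_rpow_iff hr₁] at h1
  exact lt_irrefl _ h1

/-- The height function of a rounded cone over the unit sphere. -/
def coneFun {m : ℕ} (y : Fin m → ℝ) : ℝ := √(1 - ∑ i, y i ^ 2) + ‖y‖

lemma continuous_coneFun {m : ℕ} : Continuous (coneFun (m := m)) := by
  unfold coneFun
  fun_prop

lemma sum_sq_le {m : ℕ} {r : ℝ} {y : Fin m → ℝ} (hy : ‖y‖ ≤ r) (hr : r ≤ 1 / (4 * (m + 1))) :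
    ∑ i, y i ^ 2 ≤ 1 / 4 := by
  have h0 : (0 : ℝ) ≤ r := (norm_nonneg _).trans hy
  have h4 : r * (4 * (m + 1)) ≤ 1 := (le_div_iff₀ (by positivity)).1 hr
  have hm0 : (0 : ℝ) ≤ m := by positivity
  have h5 : r ≤ 1 / 4 := by nlinarith [mul_nonneg h0 hm0]
  calc ∑ i, y i ^ 2 ≤ ∑ _i : Fin m, r ^ 2 := by
        refine Finset.sum_le_sum fun i _ => ?_
        have := (norm_le_pi_norm y i).trans hy
        rw [Real.norm_eq_abs] at this
        exact sq_le_sq' (by linarith [(abs_le.1 this).1]) (abs_le.1 this).2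
    _ = m * r * r := by simp; ring
    _ ≤ 1 / 4 := by nlinarith [mul_nonneg h0 hm0]

lemma half_le_sqrt {s : ℝ} (hs : s ≤ 1 / 4) : 1 / 2 ≤ √(1 - s) := by
  refine Real.le_sqrt_of_sq_le ?_
  norm_num; linarith

lemma lipschitz_coneFun {m : ℕ} {r : ℝ} (hr : r ≤ 1 / (4 * (m + 1))) :
    LipschitzOnWith 2 (coneFun (m := m)) (ball 0 r) := by
  refine LipschitzOnWith.of_dist_le_mul fun a ha b hb => ?_
  rw [mem_ball_zero_iff] at ha hb
  have h0 : (0 : ℝ) ≤ r := (norm_nonneg _).trans ha.le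
  have hA := half_le_sqrt (sum_sq_le ha.le hr)
  have hB := half_le_sqrt (sum_sq_le hb.le hr)
  have hA' := Real.sq_sqrt (show 0 ≤ 1 - ∑ i, a i ^ 2 by linarith [sum_sq_le ha.le hr])
  have hB' := Real.sq_sqrt (show 0 ≤ 1 - ∑ i, b i ^ 2 by linarith [sum_sq_le hb.le hr])
  have h4 : r * (4 * (m + 1)) ≤ 1 := (le_div_iff₀ (by positivity)).1 hr
  have hS : |∑ i, a i ^ 2 - ∑ i, b i ^ 2| ≤ dist a b := by
    rw [← Finset.sum_sub_distrib]
    calc |∑ i, (a i ^ 2 - b i ^ 2)| ≤ ∑ i, |a i ^ 2 - b i ^ 2| := Finset.abs_sum_le_sum_abs _ _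
      _ ≤ ∑ _i : Fin m, 2 * r * dist a b := by
          refine Finset.sum_le_sum fun i _ => ?_
          have h1 := (norm_le_pi_norm a i).trans ha.le
          have h2 := (norm_le_pi_norm b i).trans hb.le
          have h3 := dist_le_pi_dist a b i
          rw [Real.dist_eq] at h3
          rw [Real.norm_eq_abs] at h1 h2
          have : a i ^ 2 - b i ^ 2 = (a i + b i) * (a i - b i) := by ring
          rw [this, abs_mul]
          refine mul_le_mul ((abs_add_le _ _).trans (by linarith)) h3 (abs_nonneg _) (by linarith)
      _ = 2 * m * r * dist a b := by simp; ring
      _ ≤ 1 * dist a b := by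
          refine mul_le_mul_of_nonneg_right ?_ dist_nonneg
          have hm0 : (0 : ℝ) ≤ m := by positivity
          nlinarith [mul_nonneg h0 hm0]
      _ = dist a b := one_mul _
  have hR : |√(1 - ∑ i, a i ^ 2) - √(1 - ∑ i, b i ^ 2)| ≤ dist a b := by
    set A := √(1 - ∑ i, a i ^ 2)
    set B := √(1 - ∑ i, b i ^ 2)
    have h1 : |A - B| * (A + B) = |∑ i, a i ^ 2 - ∑ i, b i ^ 2| := by
      rw [← abs_of_nonneg (show 0 ≤ A + B by linarith), ← abs_mul,
        abs_sub_comm (∑ i, a i ^ 2)]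
      congr 1
      linear_combination hA' - hB'
    nlinarith [abs_nonneg (A - B)]
  have hN : |‖a‖ - ‖b‖| ≤ dist a b := by
    rw [dist_eq_norm]; exact abs_norm_sub_norm_le a b
  rw [Real.dist_eq]
  have : coneFun a - coneFun b = (√(1 - ∑ i, a i ^ 2) - √(1 - ∑ i, b i ^ 2)) + (‖a‖ - ‖b‖) := by
    simp only [coneFun]; ring
  rw [this]
  refine (abs_add_le _ _).trans ?_
  push_cast
  linarith

lemma cone_mem_ball {m : ℕ} {r : ℝ} {y : Fin m → ℝ} (hy : ‖y‖ < r) (hr : r ≤ 1 / (4 * (m + 1))) :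
    ‖slicePt (coneFun y - r) y‖ < 1 := by
  have hA := half_le_sqrt (sum_sq_le hy.le hr)
  have hA' := Real.sq_sqrt (show 0 ≤ 1 - ∑ i, y i ^ 2 by linarith [sum_sq_le hy.le hr])
  have h0 : (0 : ℝ) ≤ r := (norm_nonneg _).trans hy.le
  have h4 : r * (4 * (m + 1)) ≤ 1 := (le_div_iff₀ (by positivity)).1 hr
  have hm0 : (0 : ℝ) ≤ m := by positivity
  have h5 : r ≤ 1 / 4 := by nlinarith [mul_nonneg h0 hm0]
  have h1 := norm_slicePt_sq (coneFun y - r) y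
  have h2 : (coneFun y - r) ^ 2 < √(1 - ∑ i, y i ^ 2) ^ 2 := by
    have := norm_nonneg y
    refine pow_lt_pow_left₀ ?_ ?_ two_ne_zero
    · simp only [coneFun]; linarith
    · simp only [coneFun]; linarith
  have h3 : ‖slicePt (coneFun y - r) y‖ ^ 2 < 1 := by rw [h1]; linarith
  nlinarith [norm_nonneg (slicePt (coneFun y - r) y)]

lemma cone_pos {m : ℕ} {x : Euc (m + 1)} (hx : ‖x‖ < 1) :
    ‖fun i : Fin m => x i.succ‖ < coneFun (fun i : Fin m => x i.succ) - x 0 := by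
  have h1 := norm_slicePt_sq (x 0) (fun i : Fin m => x i.succ)
  rw [slicePt_eta] at h1
  have h2 : ‖x‖ ^ 2 < 1 := by nlinarith [norm_nonneg x]
  have h3 : x 0 < √(1 - ∑ i : Fin m, x i.succ ^ 2) := by
    refine Real.lt_sqrt_of_sq_lt ?_
    linarith
  simp only [coneFun]
  linarith

lemma exists_rot {m : ℕ} {p : Euc (m + 1)} (hp : ‖p‖ = 1) :
    ∃ R : Euc (m + 1) ≃ₗᵢ[ℝ] Euc (m + 1), R (slicePt 1 0) = p := by
  have h1 : ‖slicePt (m := m) 1 0‖ = 1 := by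
    have := norm_slicePt_sq (m := m) 1 0
    simp only [Pi.zero_apply, ne_eq, OfNat.ofNat_ne_zero, not_false_eq_true, zero_pow,
      Finset.sum_const_zero, add_zero, one_pow] at this
    nlinarith [norm_nonneg (slicePt (m := m) 1 0)]
  exact ⟨_, Submodule.reflection_sub (h1.trans hp.symm)⟩

lemma stepB {m : ℕ} (hm : 1 ≤ m) {h : Euc (m + 1) → Euc (m + 1)}
    {Dh : Euc (m + 1) → Matrix (Fin (m + 1)) (Fin (m + 1)) ℝ}
    (hh : ContinuousOn h (unitBall (m + 1)))
    (hmaps : MapsTo h (unitBall (m + 1)) (unitBall (m + 1)))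
    (hS : MemSobolev ((m + 1 : ℕ) : ℝ) (unitBall (m + 1)) h Dh)
    {p : Euc (m + 1)} (hp : ‖p‖ = 1) {s₁ s₂ : ℝ} (hs : s₁ ≠ s₂)
    (hcurve : ∀ s, (s = s₁ ∨ s = s₂) → ∃ (γ : ℝ → Euc (m + 1)) (τ₀ : ℝ), 0 < τ₀ ∧
      ContinuousOn γ (Ioo 0 τ₀) ∧ (∀ τ ∈ Ioo 0 τ₀, γ τ ∈ unitBall (m + 1) ∧ h (γ τ) 0 = s) ∧
      Tendsto γ (𝓝[>] 0) (𝓝 p)) : False := by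
  obtain ⟨R, hR⟩ := exists_rot hp
  obtain ⟨e, hem, hei, hC⟩ := slices hm R (continuous_coneFun (m := m))
    (Ω := unitBall (m + 1)) isOpen_ball measure_ball_lt_top.ne (u := fun x => h x 0) (by fun_prop)
    (fun x hx => (PiLp.norm_apply_le _ 0).trans
      (by have := hmaps hx; rw [unitBall, mem_ball_zero_iff] at this; exact this.le))
    (g := fun k x => Dh x 0 k) (fun k => hS.locIntD 0 k)
    (fun φ h1 h2 h3 k => hS.parts φ h1 h2 h3 0 k) (energy_ne_top hS.lp 0)
  obtain ⟨C, hCt, hest⟩ := hC 2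
  let pr : Euc (m + 1) → Fin m → ℝ := fun x i => (R.symm x) i.succ
  let rr : Euc (m + 1) → ℝ := fun x => coneFun (pr x) - (R.symm x) 0
  have hprc : Continuous pr := by
    have : Continuous R.symm := R.symm.continuous
    refine continuous_pi fun i => ?_
    simp only [pr]
    fun_prop
  have hrrc : Continuous rr := by
    have : Continuous R.symm := R.symm.continuous
    have h2 : Continuous fun x => (R.symm x) 0 := by fun_prop
    exact (continuous_coneFun.comp hprc).sub h2
  have hrrp : rr p = 0 := by
    have h1 : R.symm p = slicePt 1 0 := by rw [← hR, R.symm_apply_apply]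
    have h2 : pr p = 0 := by
      funext i
      simp only [pr, h1, slicePt_succ]
    simp only [rr, h2, h1, coneFun, slicePt_zero]
    simp
  have hrrpos : ∀ x ∈ unitBall (m + 1), ‖pr x‖ < rr x := by
    intro x hx
    refine cone_pos ?_
    rw [R.symm.norm_map]
    simpa [unitBall] using hx
  have hback : ∀ x, R (slicePt (coneFun (pr x) - rr x) (pr x)) = x := by
    intro x
    have : coneFun (pr x) - rr x = (R.symm x) 0 := by simp [rr]
    rw [this]
    have h2 := slicePt_eta (R.symm x)
    change R (slicePt ((R.symm x) 0) (fun i => (R.symm x) i.succ)) = x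
    rw [h2, R.apply_symm_apply]
  -- intermediate value theorem along the curves
  have ivt : ∀ s, (s = s₁ ∨ s = s₂) → ∃ η, 0 < η ∧ ∀ r, 0 < r → r < η →
      ∃ x ∈ unitBall (m + 1), rr x = r ∧ h x 0 = s := by
    intro s hs'
    obtain ⟨γ, τ₀, hτ₀, hγc, hγ, hγt⟩ := hcurve s hs'
    have hmid : τ₀ / 2 ∈ Ioo 0 τ₀ := ⟨by linarith, by linarith⟩
    refine ⟨rr (γ (τ₀ / 2)), (norm_nonneg _).trans_lt (hrrpos _ (hγ _ hmid).1), ?_⟩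
    intro r hr hr'
    have h1 : Tendsto (fun τ => rr (γ τ)) (𝓝[>] 0) (𝓝 0) := by
      have := (hrrc.tendsto p).comp hγt
      rwa [hrrp] at this
    have h2 : ∀ᶠ τ in 𝓝[>] (0 : ℝ), τ ∈ Ioo 0 (τ₀ / 2) := Ioo_mem_nhdsGT (by linarith)
    obtain ⟨τ₁, h3, h4⟩ := ((h1.eventually_lt_const hr).and h2).exists
    have hsub : Icc τ₁ (τ₀ / 2) ⊆ Ioo 0 τ₀ := fun τ hτ =>
      ⟨h4.1.trans_le hτ.1, hτ.2.trans_lt hmid.2⟩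
    obtain ⟨τ, hτ, hτr⟩ := intermediate_value_Icc h4.2.le
      (hrrc.comp_continuousOn (hγc.mono hsub)) ⟨h3.le, hr'.le⟩
    exact ⟨γ τ, (hγ τ (hsub hτ)).1, hτr, (hγ τ (hsub hτ)).2⟩
  obtain ⟨η₁, hη₁, H₁⟩ := ivt s₁ (Or.inl rfl)
  obtain ⟨η₂, hη₂, H₂⟩ := ivt s₂ (Or.inr rfl)
  have hr0 : (0 : ℝ) < 1 / (4 * (m + 1)) := by positivity
  refine not_log_bound (c := ‖s₁ - s₂‖ₑ ^ (m + 1)) hei ?_ (by finiteness) hCt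
    (lt_min (lt_min hη₁ hη₂) hr0) ?_
  · have : ‖s₁ - s₂‖ₑ ≠ 0 := by simpa [sub_eq_zero] using hs
    exact pow_ne_zero _ this
  intro r hr hr'
  obtain ⟨x₁, hx₁, hr₁, hs₁⟩ := H₁ r hr
    (hr'.trans_le ((min_le_left _ _).trans (min_le_left _ _)))
  obtain ⟨x₂, hx₂, hr₂, hs₂⟩ := H₂ r hr
    (hr'.trans_le ((min_le_left _ _).trans (min_le_right _ _)))
  have hrr0 : r ≤ 1 / (4 * (m + 1)) := (hr'.trans_le (min_le_right _ _)).le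
  have hy₁ : ‖pr x₁‖ < r := hr₁ ▸ hrrpos x₁ hx₁
  have hy₂ : ‖pr x₂‖ < r := hr₂ ▸ hrrpos x₂ hx₂
  obtain ⟨r', hr'1, hr'2⟩ := exists_between (max_lt (max_lt hy₁ hy₂) (half_lt_self hr))
  have hr'a : ‖pr x₁‖ < r' := lt_of_le_of_lt ((le_max_left _ _).trans (le_max_left _ _)) hr'1
  have hr'b : ‖pr x₂‖ < r' := lt_of_le_of_lt ((le_max_right _ _).trans (le_max_left _ _)) hr'1
  have hr'c : r / 2 < r' := lt_of_le_of_lt (le_max_right _ _) hr'1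
  have hcont : Continuous fun y : Fin m → ℝ => R (slicePt (coneFun y - r) y) :=
    R.continuous.comp (continuous_slicePt.comp
      ((continuous_coneFun.sub continuous_const).prodMk continuous_id))
  have key := hest r r (ball (0 : Fin m → ℝ) r')
    ((fun y : Fin m → ℝ => R (slicePt (coneFun y - r) y)) '' closedBall 0 r') hr
    (convex_ball _ _) measurableSet_ball (ball_subset_ball hr'2.le)
    (by
      rw [Real.volume_pi_ball _ (by linarith)]
      simp only [Fintype.card_fin]
      gcongr
      linarith)
    ((lipschitz_coneFun hrr0).mono (ball_subset_ball hr'2.le))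
    (by
      rintro _ ⟨y, hy, rfl⟩
      rw [mem_closedBall_zero_iff] at hy
      rw [unitBall, mem_ball_zero_iff, R.norm_map]
      exact cone_mem_ball (hy.trans_lt hr'2) hrr0)
    ((isCompact_closedBall _ _).image hcont)
    (fun y hy => ⟨y, ball_subset_closedBall hy, rfl⟩)
    (pr x₁) (by simpa using hr'a) (pr x₂) (by simpa using hr'b)
  have hb₁ := hback x₁
  have hb₂ := hback x₂
  rw [hr₁] at hb₁
  rw [hr₂] at hb₂
  rw [hb₁, hb₂, hs₁, hs₂] at key
  exact key

/-! ### Boundary behaviour of the homeomorphism -/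

lemma isPreconnected_sphere_diff {n : ℕ} {p : Euc n} (hp : ‖p‖ = 1) :
    IsPreconnected (sphere (0 : Euc n) 1 \ {p}) := by
  have hp0 : p ≠ 0 := by rintro rfl; simp at hp
  have hstar : StarConvex ℝ (-p) {x : Euc n | ¬ ∃ c : ℝ, 0 ≤ c ∧ x = c • p} := by
    rintro x hx a b ha hb hab ⟨c, hc, hcx⟩
    by_cases hb0 : b = 0
    · subst hb0
      have ha1 : a = 1 := by linarith
      subst ha1
      have h1 : (c + 1) • p = 0 := by
        rw [add_smul, ← hcx]; simp
      rcases smul_eq_zero.1 h1 with h | h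
      · linarith
      · exact hp0 h
    · refine hx ⟨(c + a) / b, by positivity, ?_⟩
      have h1 : b • x = (c + a) • p := by
        rw [add_smul, ← hcx]; simp
      rw [div_eq_inv_mul, mul_smul, ← h1, smul_smul, inv_mul_cancel₀ hb0, one_smul]
  have hmem : (-p) ∈ {x : Euc n | ¬ ∃ c : ℝ, 0 ≤ c ∧ x = c • p} := by
    rintro ⟨c, hc, hcx⟩
    have h1 : (c + 1) • p = 0 := by
      rw [add_smul, ← hcx]; simp
    rcases smul_eq_zero.1 h1 with h | h
    · linarith
    · exact hp0 h
  have hpc := (hstar.isPathConnected hmem).isConnected.isPreconnected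
  have hne : ∀ x ∈ {x : Euc n | ¬ ∃ c : ℝ, 0 ≤ c ∧ x = c • p}, x ≠ 0 := by
    rintro x hx rfl
    exact hx ⟨0, le_rfl, by simp⟩
  have himg := hpc.image (fun x => ‖x‖⁻¹ • x) (by
    refine ContinuousOn.smul (ContinuousOn.inv₀ continuous_norm.continuousOn ?_) continuousOn_id
    intro x hx
    exact norm_ne_zero_iff.2 (hne x hx))
  convert himg using 1
  ext z
  constructor
  · rintro ⟨hz, hzp⟩
    rw [mem_sphere_zero_iff_norm] at hz
    refine ⟨z, ?_, by simp [hz]⟩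
    rintro ⟨c, hc, hcz⟩
    have h1 : c = 1 := by
      rw [hcz, norm_smul, hp, Real.norm_of_nonneg hc, mul_one] at hz
      exact hz
    rw [h1, one_smul] at hcz
    exact hzp hcz
  · rintro ⟨x, hx, rfl⟩
    have hx0 := norm_ne_zero_iff.2 (hne x hx)
    refine ⟨?_, ?_⟩
    · rw [mem_sphere_zero_iff_norm, norm_smul, norm_inv, norm_norm, inv_mul_cancel₀ hx0]
    · intro h
      refine hx ⟨‖x‖, norm_nonneg _, ?_⟩
      have h2 : ‖x‖⁻¹ • x = p := h
      rw [← h2, smul_smul, mul_inv_cancel₀ hx0, one_smul]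

/-- Limits of the inverse along points approaching the boundary lie on the sphere. -/
lemma norm_limit_eq_one {n : ℕ} {h f : Euc n → Euc n} {Ω : Set (Euc n)}
    (hH : IsHomeoOn h f (unitBall n) Ω) {α : Type*} {l : Filter α} [l.NeBot] {g : α → Euc n}
    {q z : Euc n} (hq : q ∉ Ω) (hg : Tendsto g l (𝓝 q)) (hgΩ : ∀ᶠ a in l, g a ∈ Ω)
    (hz : Tendsto (fun a => f (g a)) l (𝓝 z)) : ‖z‖ = 1 := by
  have hle : ‖z‖ ≤ 1 := by
    refine le_of_tendsto hz.norm (hgΩ.mono fun a ha => ?_)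
    have := hH.mapsTo_inv ha
    rw [unitBall, mem_ball_zero_iff] at this
    exact this.le
  refine hle.eq_of_not_lt fun hlt => hq ?_
  have hzB : z ∈ unitBall n := by rw [unitBall, mem_ball_zero_iff]; exact hlt
  have hc : ContinuousAt h z := hH.continuousOn.continuousAt (isOpen_ball.mem_nhds hzB)
  have h1 : Tendsto (fun a => h (f (g a))) l (𝓝 (h z)) := hc.tendsto.comp hz
  have h2 : Tendsto g l (𝓝 (h z)) := h1.congr' (hgΩ.mono fun a ha => hH.right_inv _ ha)
  rw [tendsto_nhds_unique hg h2]
  exact hH.mapsTo hzB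

lemma norm_slicePt_axis {m : ℕ} (s : ℝ) : ‖slicePt (m := m) s 0‖ = |s| := by
  have := norm_slicePt_sq (m := m) s 0
  simp only [Pi.zero_apply, ne_eq, OfNat.ofNat_ne_zero, not_false_eq_true, zero_pow,
      Finset.sum_const_zero, add_zero] at this
  rw [← abs_norm, ← sq_eq_sq_iff_abs_eq_abs]
  exact this

lemma axis_mem_slit {m : ℕ} {s : ℝ} (h0 : 0 ≤ s) (h1 : s < 1) :
    slicePt (m := m) s 0 ∈ slit (m + 1) := by
  refine (mem_slit_iff (by rw [norm_slicePt_axis, abs_of_nonneg h0]; exact h1)).2 ⟨h0, ?_⟩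
  funext i
  simp

lemma stepT {m : ℕ} (hm : 1 ≤ m) {h f : Euc (m + 1) → Euc (m + 1)}
    (hH : IsHomeoOn h f (unitBall (m + 1)) (unitBall (m + 1) \ slit (m + 1)))
    {t : ℝ} (ht0 : 0 < t) (ht1 : t < 1 / 2) {p : Euc (m + 1)}
    (hlim : Tendsto (fun y : Fin m → ℝ => f (slicePt t y)) (𝓝[≠] 0) (𝓝 p)) :
    ‖p‖ = 1 ∧ ∃ s₁ s₂ : ℝ, s₁ ≠ s₂ ∧ ∀ s, (s = s₁ ∨ s = s₂) →
      ∃ (γ : ℝ → Euc (m + 1)) (τ₀ : ℝ), 0 < τ₀ ∧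
      ContinuousOn γ (Ioo 0 τ₀) ∧ (∀ τ ∈ Ioo 0 τ₀, γ τ ∈ unitBall (m + 1) ∧ h (γ τ) 0 = s) ∧
      Tendsto γ (𝓝[>] 0) (𝓝 p) := by
  have hne : Nonempty (Fin m) := ⟨⟨0, by omega⟩⟩
  have hmpos : (0 : ℝ) < m := by positivity
  have hslc : ∀ s : ℝ, Continuous fun y : Fin m → ℝ => slicePt s y := fun s =>
    continuous_slicePt.comp (continuous_const.prodMk continuous_id)
  have hmemΩ : ∀ (s : ℝ) (y : Fin m → ℝ), y ≠ 0 → |s| + m * ‖y‖ < 1 →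
      slicePt s y ∈ unitBall (m + 1) \ slit (m + 1) := fun s y hy hs =>
    ⟨by rw [unitBall, mem_ball_zero_iff]; exact (norm_slicePt_le s y).trans_lt hs,
      slicePt_notMem_slit s hy⟩
  have hp : ‖p‖ = 1 := by
    refine norm_limit_eq_one hH (q := slicePt t 0) (g := fun y => slicePt t y)
      (fun hq => hq.2 (axis_mem_slit ht0.le (by linarith)))
      ((hslc t).tendsto 0 |>.mono_left nhdsWithin_le_nhds) ?_ hlim
    have h1 : ∀ᶠ y : Fin m → ℝ in 𝓝[≠] 0, |t| + m * ‖y‖ < 1 := by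
      have : Tendsto (fun y : Fin m → ℝ => |t| + m * ‖y‖) (𝓝[≠] 0)
          (𝓝 (|t| + m * ‖(0 : Fin m → ℝ)‖)) := by
        refine Tendsto.mono_left (Continuous.tendsto ?_ 0) nhdsWithin_le_nhds
        fun_prop
      refine this.eventually_lt_const ?_
      rw [norm_zero, mul_zero, add_zero, abs_of_pos ht0]
      linarith
    filter_upwards [h1, self_mem_nhdsWithin] with y hy hy0
    exact hmemΩ t y hy0 hy
  refine ⟨hp, ?_⟩
  -- the two open sides and the separating surface
  let O₁ : Set (Euc (m + 1)) := {x | ‖x‖ < 1 / 2} ∩ {x | x 0 < t}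
  let O₂ : Set (Euc (m + 1)) := {x | 1 / 2 < ‖x‖} ∪ {x | t < x 0}
  have hc0 : Continuous fun x : Euc (m + 1) => x 0 := by fun_prop
  have hO₁ : IsOpen O₁ := (isOpen_lt continuous_norm continuous_const).inter
    (isOpen_lt hc0 continuous_const)
  have hO₂ : IsOpen O₂ := (isOpen_lt continuous_const continuous_norm).union
    (isOpen_lt continuous_const hc0)
  have hdisj : Disjoint O₁ O₂ := by
    rw [Set.disjoint_left]
    rintro x ⟨h1, h2⟩ (h3 | h3)
    · exact lt_asymm (show ‖x‖ < 1 / 2 from h1) h3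
    · exact lt_asymm (show x 0 < t from h2) h3
  let F : Set (Euc (m + 1)) := (O₁ ∪ O₂)ᶜ
  have hFc : IsClosed F := (hO₁.union hO₂).isClosed_compl
  have hFn : ∀ x ∈ F, ‖x‖ ≤ 1 / 2 ∧ x 0 ≤ t ∧ (‖x‖ < 1 / 2 → x 0 = t) := by
    intro x hx
    have h1 : ‖x‖ ≤ 1 / 2 := by
      by_contra hcon
      exact hx (Or.inr (Or.inl (not_le.1 hcon)))
    have h2 : x 0 ≤ t := by
      by_contra hcon
      exact hx (Or.inr (Or.inr (not_le.1 hcon)))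
    refine ⟨h1, h2, fun h3 => h2.eq_of_not_lt fun h4 => hx (Or.inl ⟨h3, h4⟩)⟩
  have hFK : IsCompact F := (isCompact_closedBall (0 : Euc (m + 1)) (1 / 2)).of_isClosed_subset hFc
    fun x hx => by rw [mem_closedBall_zero_iff]; exact (hFn x hx).1
  -- the surface stays away from boundary points other than `p`
  have hsep : ∀ z ∈ sphere (0 : Euc (m + 1)) 1 \ {p}, ∃ ε > 0, ∀ x ∈ ball z ε ∩ unitBall (m + 1),
      h x ∉ F := by
    rintro z ⟨hz, hzp⟩
    rw [mem_sphere_zero_iff_norm] at hz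
    by_contra hcon
    push Not at hcon
    have hcl : z ∈ closure {x | x ∈ unitBall (m + 1) ∧ h x ∈ F} := by
      rw [Metric.mem_closure_iff]
      intro ε hε
      obtain ⟨x, ⟨hx1, hx2⟩, hx3⟩ := hcon ε hε
      exact ⟨x, ⟨hx2, hx3⟩, by rw [dist_comm]; exact hx1⟩
    obtain ⟨𝒰, hUmem, hUz⟩ := mem_closure_iff_ultrafilter.1 hcl
    have hUB : ∀ᶠ x in (𝒰 : Filter _), x ∈ unitBall (m + 1) := mem_of_superset hUmem fun x hx => hx.1
    have hUF : ∀ᶠ x in (𝒰 : Filter _), h x ∈ F := mem_of_superset hUmem fun x hx => hx.2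
    obtain ⟨w, hwF, hw⟩ := hFK.ultrafilter_le_nhds (𝒰.map h) (by
      rw [le_principal_iff]; exact hUF)
    have hw' : Tendsto h 𝒰 (𝓝 w) := hw
    have hid : Tendsto (fun x => x) (𝒰 : Filter _) (𝓝 z) := hUz
    have hwn : ‖w‖ < 1 := by linarith [(hFn w hwF).1]
    have hback : Tendsto (fun x => f (h x)) 𝒰 (𝓝 z) :=
      hid.congr' (hUB.mono fun x hx => (hH.left_inv x hx).symm)
    by_cases hws : w ∈ slit (m + 1)
    · obtain ⟨hw0, hwr⟩ := (mem_slit_iff hwn).1 hws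
      have hweq : w = slicePt (w 0) 0 := by
        conv_lhs => rw [← slicePt_eta w, hwr]
      have hwnorm : ‖w‖ = w 0 := by
        rw [hweq, norm_slicePt_axis]; simp [abs_of_nonneg hw0]
      have hwlt : ‖w‖ < 1 / 2 := by linarith [(hFn w hwF).2.1]
      have hev : ∀ᶠ x in (𝒰 : Filter _), ‖h x‖ < 1 / 2 := hw'.norm.eventually_lt_const hwlt
      have hpr : Continuous fun x : Euc (m + 1) => fun i : Fin m => x i.succ := by fun_prop
      have hy : Tendsto (fun x => fun i : Fin m => h x i.succ) 𝒰 (𝓝[≠] 0) := by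
        rw [tendsto_nhdsWithin_iff]
        constructor
        · have := (hpr.tendsto w).comp hw'
          rw [hwr] at this
          exact this
        · filter_upwards [hUB, hUF, hev] with x hxB hxF hx2 hx0
          have h1 := (hFn _ hxF).2.2 hx2
          have h2 := hH.mapsTo hxB
          refine h2.2 ((mem_slit_iff (by linarith)).2 ⟨by rw [h1]; exact ht0.le, hx0⟩)
      have h3 := hlim.comp hy
      have h4 : Tendsto (fun x => f (h x)) 𝒰 (𝓝 p) := by
        refine h3.congr' ?_
        filter_upwards [hUF, hev] with x hxF hx2
        have h1 := (hFn _ hxF).2.2 hx2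
        have h5 := slicePt_eta (h x)
        rw [h1] at h5
        simp only [Function.comp]
        rw [h5]
      exact hzp (tendsto_nhds_unique hback h4)
    · have hwΩ : w ∈ unitBall (m + 1) \ slit (m + 1) :=
        ⟨by rw [unitBall, mem_ball_zero_iff]; exact hwn, hws⟩
      have hfc : ContinuousAt f w :=
        hH.continuousOn_inv.continuousAt (isOpen_slitBall.mem_nhds hwΩ)
      have h1 := tendsto_nhds_unique hback (hfc.tendsto.comp hw')
      have h2 := hH.mapsTo_inv hwΩ
      rw [← h1, unitBall, mem_ball_zero_iff] at h2
      linarith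
  -- constant label
  let V : Set (Euc (m + 1)) → Set (Euc (m + 1)) := fun O =>
    {z | ∃ ε > 0, ∀ x ∈ ball z ε ∩ unitBall (m + 1), h x ∈ O}
  have hVo : ∀ O, IsOpen (V O) := by
    intro O
    rw [Metric.isOpen_iff]
    rintro z ⟨ε, hε, hz⟩
    refine ⟨ε / 2, by positivity, fun z' hz' => ⟨ε / 2, by positivity, fun x hx => hz x ⟨?_, hx.2⟩⟩⟩
    have h1 := dist_triangle x z' z
    have h2 : dist x z' < ε / 2 := hx.1
    have h3 : dist z' z < ε / 2 := hz'
    rw [mem_ball]; linarith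
  have hVcov : sphere (0 : Euc (m + 1)) 1 \ {p} ⊆ V O₁ ∪ V O₂ := by
    intro z hz
    obtain ⟨ε, hε, hzε⟩ := hsep z hz
    have hpre : IsPreconnected (h '' (ball z ε ∩ unitBall (m + 1))) :=
      ((convex_ball z ε).inter (convex_ball 0 1)).isPreconnected.image h
        (hH.continuousOn.mono inter_subset_right)
    have hsub : h '' (ball z ε ∩ unitBall (m + 1)) ⊆ O₁ ∪ O₂ := by
      rintro _ ⟨x, hx, rfl⟩
      exact not_not.1 (hzε x hx)
    rcases hpre.subset_or_subset hO₁ hO₂ hdisj hsub with h1 | h1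
    · exact Or.inl ⟨ε, hε, fun x hx => h1 ⟨x, hx, rfl⟩⟩
    · exact Or.inr ⟨ε, hε, fun x hx => h1 ⟨x, hx, rfl⟩⟩
  have hVdis : sphere (0 : Euc (m + 1)) 1 \ {p} ∩ (V O₁ ∩ V O₂) = ∅ := by
    rw [Set.eq_empty_iff_forall_notMem]
    rintro z ⟨⟨hz, -⟩, ⟨ε₁, hε₁, h1⟩, ⟨ε₂, hε₂, h2⟩⟩
    have hzc : z ∈ closure (unitBall (m + 1)) := by
      rw [unitBall, closure_ball _ one_ne_zero]
      exact sphere_subset_closedBall hz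
    obtain ⟨x, hxB, hx⟩ := Metric.mem_closure_iff.1 hzc _ (lt_min hε₁ hε₂)
    rw [dist_comm] at hx
    exact Set.disjoint_left.1 hdisj (h1 x ⟨hx.trans_le (min_le_left _ _), hxB⟩)
      (h2 x ⟨hx.trans_le (min_le_right _ _), hxB⟩)
  have hlab := isPreconnected_iff_subset_of_disjoint.1 (isPreconnected_sphere_diff hp)
    (V O₁) (V O₂) (hVo _) (hVo _) hVcov hVdis
  -- conclusion for a side not seen from the sphere
  have main : ∀ O O' : Set (Euc (m + 1)), IsOpen O → Disjoint O' O →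
      sphere (0 : Euc (m + 1)) 1 \ {p} ⊆ V O' → ∀ s : ℝ, 0 ≤ s → s < 1 →
      slicePt s 0 ∈ O → ∃ (γ : ℝ → Euc (m + 1)) (τ₀ : ℝ), 0 < τ₀ ∧
      ContinuousOn γ (Ioo 0 τ₀) ∧ (∀ τ ∈ Ioo 0 τ₀, γ τ ∈ unitBall (m + 1) ∧ h (γ τ) 0 = s) ∧
      Tendsto γ (𝓝[>] 0) (𝓝 p) := by
    intro O O' hO hOO hV s hs0 hs1 hsO
    let c : ℝ → Euc (m + 1) := fun τ => slicePt s (fun _ => τ)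
    have hcc : Continuous c := (hslc s).comp (continuous_pi fun _ => continuous_id)
    have hτ₀ : 0 < (1 - s) / m := div_pos (by linarith) hmpos
    have hcΩ : ∀ τ ∈ Ioo 0 ((1 - s) / m), c τ ∈ unitBall (m + 1) \ slit (m + 1) := by
      rintro τ ⟨h1, h2⟩
      refine hmemΩ s _ ?_ ?_
      · intro h3
        have := congrFun h3 (Classical.arbitrary _)
        simp only [Pi.zero_apply] at this
        exact h1.ne' this
      · rw [pi_norm_const, Real.norm_of_nonneg h1.le, abs_of_nonneg hs0]
        rw [lt_div_iff₀ hmpos] at h2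
        linarith
    refine ⟨fun τ => f (c τ), (1 - s) / m, hτ₀,
      hH.continuousOn_inv.comp hcc.continuousOn hcΩ, fun τ hτ =>
        ⟨hH.mapsTo_inv (hcΩ τ hτ), by rw [hH.right_inv _ (hcΩ τ hτ)]; rfl⟩, ?_⟩
    rw [tendsto_iff_ultrafilter]
    intro 𝒰 hU
    have hUI : ∀ᶠ τ in (𝒰 : Filter ℝ), τ ∈ Ioo 0 ((1 - s) / m) := hU (Ioo_mem_nhdsGT hτ₀)
    obtain ⟨z, -, hz⟩ := (isCompact_closedBall (0 : Euc (m + 1)) 1).ultrafilter_le_nhds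
      (𝒰.map fun τ => f (c τ)) (by
        rw [le_principal_iff]
        refine hUI.mono fun τ hτ => ?_
        exact ball_subset_closedBall (hH.mapsTo_inv (hcΩ τ hτ)))
    have hz' : Tendsto (fun τ => f (c τ)) 𝒰 (𝓝 z) := hz
    have hct : Tendsto c 𝒰 (𝓝 (slicePt s 0)) :=
      ((hcc.tendsto 0).mono_left nhdsWithin_le_nhds).mono_left hU
    have hz1 : ‖z‖ = 1 := norm_limit_eq_one hH (g := c)
      (fun hq => hq.2 (axis_mem_slit hs0 hs1)) hct (hUI.mono hcΩ) hz'
    by_cases hzp : z = p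
    · rw [← hzp]; exact hz
    exfalso
    obtain ⟨ε, hε, hzε⟩ := hV ⟨by rw [mem_sphere_zero_iff_norm]; exact hz1, hzp⟩
    have h1 : ∀ᶠ τ in (𝒰 : Filter ℝ), f (c τ) ∈ ball z ε := hz' (ball_mem_nhds z hε)
    have h2 : ∀ᶠ τ in (𝒰 : Filter ℝ), c τ ∈ O := hct (hO.mem_nhds hsO)
    obtain ⟨τ, hτ1, hτ2, hτ3⟩ := (h1.and (h2.and hUI)).exists
    have h3 := hzε _ ⟨hτ1, hH.mapsTo_inv (hcΩ τ hτ3)⟩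
    rw [hH.right_inv _ (hcΩ τ hτ3)] at h3
    exact Set.disjoint_left.1 hOO h3 hτ2
  rcases hlab with hl | hl
  · refine ⟨3 / 5, 4 / 5, by norm_num, fun s hs => ?_⟩
    have hs' : 1 / 2 < s ∧ s < 1 := by rcases hs with rfl | rfl <;> norm_num
    refine main O₂ O₁ hO₂ hdisj hl s (by linarith [hs'.1]) hs'.2 (Or.inl ?_)
    change 1 / 2 < ‖slicePt (m := m) s 0‖
    rw [norm_slicePt_axis, abs_of_nonneg (by linarith [hs'.1])]
    exact hs'.1
  · refine ⟨t / 2, t / 3, by intro hh; linarith, fun s hs => ?_⟩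
    have hs' : 0 < s ∧ s < t := by rcases hs with rfl | rfl <;> constructor <;> linarith
    refine main O₁ O₂ hO₁ hdisj.symm hl s hs'.1.le (by linarith [hs'.2]) ⟨?_, hs'.2⟩
    change ‖slicePt (m := m) s 0‖ < 1 / 2
    rw [norm_slicePt_axis, abs_of_pos hs'.1]
    linarith [hs'.2]
/-- For `n ≥ 3` there is no homeomorphism of finite bi-conformal energy from
the unit ball onto the slit ball `𝔹 ∖ I`. -/
theorem stmt_3 {n : ℕ} [NeZero n] (hn : 3 ≤ n) :
    ¬ ∃ (h f : Euc n → Euc n) (Dh Df : Euc n → Matrix (Fin n) (Fin n) ℝ),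
        IsHomeoOn h f (unitBall n) (unitBall n \ slit n) ∧
        MemSobolev (n : ℝ) (unitBall n) h Dh ∧
        MemSobolev (n : ℝ) (unitBall n \ slit n) f Df := by
  rintro ⟨h, f, Dh, Df, hH, hSh, hSf⟩
  obtain ⟨m, rfl⟩ : ∃ m, n = m + 1 := ⟨n - 1, by omega⟩
  have hm : 2 ≤ m := by omega
  obtain ⟨t, ht0, ht1, p, hlim⟩ := stepA hm hH.continuousOn_inv hH.mapsTo_inv hSf
  obtain ⟨hp, s₁, s₂, hs, hcurve⟩ := stepT (by omega) hH ht0 ht1 hlim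
  exact stepB (by omega) hH.continuousOn (fun x hx => (hH.mapsTo hx).1) hSh hp hs hcurve
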